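/- Let 1 ≤ α < β < ∞. The piecewise affine skew product S̃ admits a unique (subject to the normalization ν(Δ₀) = 1) S̃-invariant σ-finite measure ν on I × I absolutely continuous with respect to m × m, and this measure is infinite: ν(I × I) = ∞. -/

import Mathlib

open MeasureTheory Filter Set Topology

noncomputable section

/-- The Liverani–Saussol–Vaienti map `T_a` on `[0,1]`. -/
def lsv (a x : ℝ) : ℝ := if x ≤ 1 / 2 then x * (1 + (2 : ℝ) ^ a * x ^ a) else 2 * x - 1

/-- Random parameter selection: `α` on `[0,p₁)`, `β` on `[p₁,1]`. -/
def alphaOf (α β p₁ ω : ℝ) : ℝ := if ω < p₁ then α else β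

/-- The noise dynamics `φ` on `[0,1]`. -/
def phiMap (p₁ ω : ℝ) : ℝ := if ω < p₁ then ω / p₁ else (ω - p₁) / (1 - p₁)

/-- The skew product `S(x,ω) = (T_{α(ω)} x, φ ω)`. -/
def skewLSV (α β p₁ : ℝ) (p : ℝ × ℝ) : ℝ × ℝ :=
  (lsv (alphaOf α β p₁ p.2) p.1, phiMap p₁ p.2)

/-- The base of inducing, `Δ₀ = (1/2,1] × [0,1]`. -/
def Δ0 : Set (ℝ × ℝ) := Ioc (1 / 2 : ℝ) 1 ×ˢ Icc (0 : ℝ) 1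

/-- The skew product of a random (ω-dependent) interval map. -/
def skewOf (Tt : ℝ → ℝ → ℝ) (p₁ : ℝ) (p : ℝ × ℝ) : ℝ × ℝ :=
  (Tt p.2 p.1, phiMap p₁ p.2)

section Tower

variable {Ω : Type*}

/-- A self-map `S` of a tower with levels `Δ n`: level `n + 1` is mapped into level `n`, and the
base `Δ 0` is mapped into the union of all levels. -/
structure IsTower (S : Ω → Ω) (Δ : ℕ → Set Ω) : Prop where
  eq_of_mem : ∀ {m n : ℕ} {p : Ω}, p ∈ Δ m → p ∈ Δ n → m = n
  mapsTo_succ : ∀ n, MapsTo S (Δ (n + 1)) (Δ n)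
  mapsTo_zero : MapsTo S (Δ 0) (⋃ n, Δ n)

/-- The points of level `n + k` which are mapped into `A` after `k` steps. -/
def towerLift (S : Ω → Ω) (Δ : ℕ → Set Ω) (n k : ℕ) (A : Set Ω) : Set Ω :=
  Δ (n + k) ∩ S^[k] ⁻¹' A

/-- `F` is the first return map to the base of the tower. -/
def IsReturnMap (S : Ω → Ω) (Δ : ℕ → Set Ω) (F : Ω → Ω) : Prop :=
  ∀ p k, S p ∈ Δ k → F p = S^[k + 1] p

variable {S F : Ω → Ω} {Δ : ℕ → Set Ω}

namespace IsTower

theorem iterate_mem (hT : IsTower S Δ) (n k : ℕ) : MapsTo S^[k] (Δ (n + k)) (Δ n) := by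
  induction k generalizing n with
  | zero => intro p hp; simpa using hp
  | succ k ih =>
    intro p hp
    rw [Function.iterate_succ_apply]
    exact ih n (hT.mapsTo_succ (n + k) hp)

theorem pairwise_disjoint (hT : IsTower S Δ) : Pairwise (Function.onFun Disjoint Δ) := by
  intro m n hmn
  exact Set.disjoint_left.2 fun p hm hn => hmn (hT.eq_of_mem hm hn)

theorem preimage_inter_iUnion (hT : IsTower S Δ) {n : ℕ} {A : Set Ω} (hA : A ⊆ Δ n) :
    S ⁻¹' A ∩ ⋃ m, Δ m = (S ⁻¹' A ∩ Δ 0) ∪ (S ⁻¹' A ∩ Δ (n + 1)) := by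
  ext p
  simp only [mem_inter_iff, mem_iUnion, mem_union, mem_preimage]
  constructor
  · rintro ⟨hp, m, hm⟩
    rcases m with _ | m
    · exact Or.inl ⟨hp, hm⟩
    · have := hT.eq_of_mem (hA hp) (hT.mapsTo_succ m hm)
      subst this
      exact Or.inr ⟨hp, hm⟩
  · rintro (⟨h, h'⟩ | ⟨h, h'⟩)
    · exact ⟨h, 0, h'⟩
    · exact ⟨h, n + 1, h'⟩

theorem towerLift_succ (hT : IsTower S Δ) (n k : ℕ) (A : Set Ω) :
    S ⁻¹' towerLift S Δ n k A ∩ Δ (n + k + 1) = towerLift S Δ n (k + 1) A := by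
  ext p
  simp only [towerLift, mem_inter_iff, mem_preimage, Function.iterate_succ_apply]
  constructor
  · rintro ⟨⟨-, h⟩, h'⟩
    exact ⟨h', h⟩
  · rintro ⟨h, h'⟩
    exact ⟨⟨hT.mapsTo_succ _ h, h'⟩, h⟩

theorem towerLift_preimage (n k : ℕ) (A : Set Ω) (hT : IsTower S Δ) :
    towerLift S Δ (n + 1) k (S ⁻¹' A ∩ Δ (n + 1)) = towerLift S Δ n (k + 1) A := by
  ext p
  simp only [towerLift, mem_inter_iff, mem_preimage]
  rw [show n + 1 + k = n + (k + 1) by omega, Function.iterate_succ_apply']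
  constructor
  · rintro ⟨h, h', -⟩
    exact ⟨h, h'⟩
  · rintro ⟨h, h'⟩
    refine ⟨h, h', hT.iterate_mem (n + 1) k ?_⟩
    rwa [show n + 1 + k = n + (k + 1) by omega]

theorem towerLift_subset (n k : ℕ) (A : Set Ω) : towerLift S Δ n k A ⊆ Δ (n + k) :=
  inter_subset_left

theorem towerLift_zero {n : ℕ} {A : Set Ω} (hA : A ⊆ Δ n) : towerLift S Δ n 0 A = A := by
  simp only [towerLift, add_zero, Function.iterate_zero, preimage_id_eq, id]
  exact inter_eq_right.2 hA

theorem towerLift_self (hT : IsTower S Δ) (n k : ℕ) :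
    towerLift S Δ n k (Δ n) = Δ (n + k) :=
  inter_eq_left.2 (hT.iterate_mem n k)

theorem iUnion_ge_inter_preimage (hT : IsTower S Δ) {n : ℕ} (k : ℕ) {A : Set Ω} (hA : A ⊆ Δ n) :
    (⋃ j, Δ (j + k)) ∩ S^[k] ⁻¹' A = towerLift S Δ n k A := by
  ext p
  simp only [towerLift, mem_inter_iff, mem_preimage, mem_iUnion]
  constructor
  · rintro ⟨⟨j, hj⟩, h⟩
    have := hT.eq_of_mem (hT.iterate_mem j k hj) (hA h)
    subst this
    exact ⟨hj, h⟩
  · rintro ⟨h, h'⟩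
    exact ⟨⟨n, h⟩, h'⟩

theorem returnMap_mem (hT : IsTower S Δ) (hF : IsReturnMap S Δ F) : MapsTo F (Δ 0) (Δ 0) := by
  intro p hp
  obtain ⟨k, hk⟩ := mem_iUnion.1 (hT.mapsTo_zero hp)
  rw [hF p k hk, Function.iterate_succ_apply]
  exact hT.iterate_mem 0 k (by simpa using hk)

variable [MeasurableSpace Ω]

theorem measurableSet_towerLift (hS : Measurable S) (hΔ : ∀ n, MeasurableSet (Δ n)) (n k : ℕ)
    {A : Set Ω} (hA : MeasurableSet A) : MeasurableSet (towerLift S Δ n k A) :=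
  (hΔ _).inter ((hS.iterate k) hA)

/-- The measure of a set is the sum of the measures of its slices along the levels. -/
theorem measure_eq_tsum (hT : IsTower S Δ) (hΔ : ∀ n, MeasurableSet (Δ n)) {ν : Measure Ω}
    (hν : ν (⋃ n, Δ n)ᶜ = 0) {B : Set Ω} (hB : MeasurableSet B) :
    ν B = ∑' n, ν (B ∩ Δ n) := by
  rw [← measure_inter_add_sdiff B (MeasurableSet.iUnion hΔ),
    measure_mono_null (fun p hp => hp.2 : B \ ⋃ n, Δ n ⊆ (⋃ n, Δ n)ᶜ) hν, add_zero,
    inter_iUnion, measure_iUnion _ fun n => hB.inter (hΔ n)]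
  intro m n hmn
  exact (hT.pairwise_disjoint hmn).mono inter_subset_right inter_subset_right

theorem measure_eq_of_subset_level (hT : IsTower S Δ) (hΔ : ∀ n, MeasurableSet (Δ n))
    (hS : Measurable S) {ν : Measure Ω} (hν : ν (⋃ n, Δ n)ᶜ = 0)
    {n : ℕ} {A : Set Ω} (hA : A ⊆ Δ n) (hAm : MeasurableSet A) :
    ν (S ⁻¹' A) = ν (S ⁻¹' A ∩ Δ 0) + ν (S ⁻¹' A ∩ Δ (n + 1)) := by
  rw [← measure_inter_add_sdiff (S ⁻¹' A) (MeasurableSet.iUnion hΔ),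
    measure_mono_null (fun p hp => hp.2 : S ⁻¹' A \ ⋃ n, Δ n ⊆ (⋃ n, Δ n)ᶜ) hν, add_zero,
    hT.preimage_inter_iUnion hA, measure_union _ ((hS hAm).inter (hΔ _))]
  exact (hT.pairwise_disjoint (Nat.succ_ne_zero n).symm).mono inter_subset_right
    inter_subset_right

theorem measure_eq_sum_add (hT : IsTower S Δ) (hΔ : ∀ n, MeasurableSet (Δ n))
    {ν : Measure Ω} (hS : MeasurePreserving S ν ν) (hν : ν (⋃ n, Δ n)ᶜ = 0)
    {n : ℕ} {A : Set Ω} (hA : A ⊆ Δ n) (hAm : MeasurableSet A) (K : ℕ) :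
    ν A = ∑ k ∈ Finset.range K, ν (S ⁻¹' towerLift S Δ n k A ∩ Δ 0) +
      ν (towerLift S Δ n K A) := by
  induction K with
  | zero => simp [towerLift_zero hA]
  | succ K ih =>
    have hm := measurableSet_towerLift hS.measurable hΔ n K hAm
    rw [ih, Finset.sum_range_succ, add_assoc, ← hT.towerLift_succ,
      ← hS.measure_preimage hm.nullMeasurableSet,
      hT.measure_eq_of_subset_level hΔ hS.measurable hν (towerLift_subset n K A) hm]

theorem tendsto_measure_level (hT : IsTower S Δ) (hΔ : ∀ n, MeasurableSet (Δ n))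
    {ν : Measure Ω} (hS : MeasurePreserving S ν ν) (hν : ν (⋃ n, Δ n)ᶜ = 0)
    (hfin : ν (Δ 0) ≠ ⊤) : Tendsto (fun n => ν (Δ n)) atTop (𝓝 0) := by
  have hsum : ∑' k, ν (S ⁻¹' Δ k ∩ Δ 0) = ν (Δ 0) := by
    rw [← measure_iUnion _ fun k => (hS.measurable (hΔ k)).inter (hΔ 0)]
    · congr 1
      ext p
      simp only [mem_iUnion, mem_inter_iff, mem_preimage]
      constructor
      · rintro ⟨k, -, h⟩
        exact h
      · intro h
        obtain ⟨k, hk⟩ := mem_iUnion.1 (hT.mapsTo_zero h)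
        exact ⟨k, hk, h⟩
    · intro m n hmn
      exact ((hT.pairwise_disjoint hmn).preimage S).mono inter_subset_left inter_subset_left
  have key : ∀ K, ν (Δ K) = ν (Δ 0) - ∑ k ∈ Finset.range K, ν (S ⁻¹' Δ k ∩ Δ 0) := by
    intro K
    have h := hT.measure_eq_sum_add hΔ hS hν subset_rfl (hΔ 0) K
    simp only [hT.towerLift_self, zero_add] at h
    refine ENNReal.eq_sub_of_add_eq' hfin ?_
    rw [add_comm]
    exact h.symm
  have hlim := ENNReal.tendsto_nat_tsum fun k => ν (S ⁻¹' Δ k ∩ Δ 0)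
  rw [hsum] at hlim
  have := ENNReal.Tendsto.sub (tendsto_const_nhds (x := ν (Δ 0))) hlim (Or.inl hfin)
  rw [tsub_self] at this
  exact this.congr fun K => (key K).symm

theorem measure_eq_tsum_base (hT : IsTower S Δ) (hΔ : ∀ n, MeasurableSet (Δ n))
    {ν : Measure Ω} (hS : MeasurePreserving S ν ν) (hν : ν (⋃ n, Δ n)ᶜ = 0)
    (hfin : ν (Δ 0) ≠ ⊤) {n : ℕ} {A : Set Ω} (hA : A ⊆ Δ n) (hAm : MeasurableSet A) :
    ν A = ∑' k, ν (S ⁻¹' towerLift S Δ n k A ∩ Δ 0) := by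
  have h0 : Tendsto (fun K => ν (towerLift S Δ n K A)) atTop (𝓝 0) := by
    refine tendsto_of_tendsto_of_tendsto_of_le_of_le tendsto_const_nhds
      ((hT.tendsto_measure_level hΔ hS hν hfin).comp (tendsto_add_atTop_nat n))
      (fun _ => bot_le) fun K => ?_
    simp only [Function.comp_apply, add_comm K n]
    exact measure_mono (towerLift_subset n K A)
  have h1 := (ENNReal.tendsto_nat_tsum fun k => ν (S ⁻¹' towerLift S Δ n k A ∩ Δ 0)).add h0
  rw [add_zero] at h1
  exact tendsto_nhds_unique
    (tendsto_const_nhds.congr fun K => hT.measure_eq_sum_add hΔ hS hν hA hAm K) h1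

/-- An invariant measure is determined by its restriction to the base. -/
theorem measure_ext (hT : IsTower S Δ) (hΔ : ∀ n, MeasurableSet (Δ n))
    {ν ν' : Measure Ω} (hS : MeasurePreserving S ν ν) (hS' : MeasurePreserving S ν' ν')
    (hν : ν (⋃ n, Δ n)ᶜ = 0) (hν' : ν' (⋃ n, Δ n)ᶜ = 0)
    (hfin : ν (Δ 0) ≠ ⊤) (h : ν.restrict (Δ 0) = ν'.restrict (Δ 0)) : ν = ν' := by
  have hr : ∀ B, MeasurableSet B → ν (B ∩ Δ 0) = ν' (B ∩ Δ 0) := fun B hB => by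
    rw [← Measure.restrict_apply hB, h, Measure.restrict_apply hB]
  have hfin' : ν' (Δ 0) ≠ ⊤ := by
    have := hr _ (hΔ 0)
    rw [inter_self] at this
    rwa [← this]
  refine Measure.ext fun B hB => ?_
  rw [hT.measure_eq_tsum hΔ hν hB, hT.measure_eq_tsum hΔ hν' hB]
  refine tsum_congr fun n => ?_
  have hBn := hB.inter (hΔ n)
  rw [hT.measure_eq_tsum_base hΔ hS hν hfin inter_subset_right hBn,
    hT.measure_eq_tsum_base hΔ hS' hν' hfin' inter_subset_right hBn]
  exact tsum_congr fun k =>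
    hr _ (hS.measurable (measurableSet_towerLift hS.measurable hΔ n k hBn))

theorem measure_preimage_returnMap (hT : IsTower S Δ) (hΔ : ∀ n, MeasurableSet (Δ n))
    (hS : Measurable S) (hF : IsReturnMap S Δ F) {μ : Measure Ω} (hμ : μ (Δ 0)ᶜ = 0)
    {A : Set Ω} (hAm : MeasurableSet A) :
    μ (F ⁻¹' A) = ∑' k, μ (S ⁻¹' towerLift S Δ 0 k A) := by
  have hn : ∀ B : Set Ω, MeasurableSet B → μ (B ∩ Δ 0) = μ B := fun B hB => by
    rw [measure_inter_conull hμ]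
  have heq : F ⁻¹' A ∩ Δ 0 = ⋃ k, (S ⁻¹' towerLift S Δ 0 k A ∩ Δ 0) := by
    ext p
    simp only [mem_iUnion, mem_inter_iff, mem_preimage, towerLift, zero_add]
    constructor
    · rintro ⟨h, hp⟩
      obtain ⟨k, hk⟩ := mem_iUnion.1 (hT.mapsTo_zero hp)
      rw [hF p k hk, Function.iterate_succ_apply] at h
      exact ⟨k, ⟨hk, h⟩, hp⟩
    · rintro ⟨k, ⟨hk, h⟩, hp⟩
      rw [hF p k hk, Function.iterate_succ_apply]
      exact ⟨h, hp⟩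
  rw [← measure_inter_conull hμ, heq, measure_iUnion]
  · exact tsum_congr fun k => hn _ (hS (measurableSet_towerLift hS hΔ 0 k hAm))
  · intro m n hmn
    refine ((hT.pairwise_disjoint hmn).preimage S).mono ?_ ?_ <;>
    · refine inter_subset_left.trans (preimage_mono ?_)
      simpa using towerLift_subset (S := S) (Δ := Δ) 0 _ A
  · exact fun k => (hS (measurableSet_towerLift hS hΔ 0 k hAm)).inter (hΔ 0)

/-- The return map preserves the restriction of an invariant measure to the base. -/
theorem measurePreserving_returnMap (hT : IsTower S Δ) (hΔ : ∀ n, MeasurableSet (Δ n))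
    (hFm : Measurable F) (hF : IsReturnMap S Δ F) {ν : Measure Ω}
    (hS : MeasurePreserving S ν ν) (hν : ν (⋃ n, Δ n)ᶜ = 0) (hfin : ν (Δ 0) ≠ ⊤) :
    MeasurePreserving F (ν.restrict (Δ 0)) (ν.restrict (Δ 0)) := by
  refine ⟨hFm, Measure.ext fun B hB => ?_⟩
  have h0 : (ν.restrict (Δ 0)) (Δ 0)ᶜ = 0 := by
    rw [Measure.restrict_apply (hΔ 0).compl, compl_inter_self, measure_empty]
  have hA := hB.inter (hΔ 0)
  rw [Measure.map_apply hFm hB, Measure.restrict_apply hB,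
    hT.measure_eq_tsum_base hΔ hS hν hfin inter_subset_right hA]
  have h1 : (ν.restrict (Δ 0)) (F ⁻¹' B) = (ν.restrict (Δ 0)) (F ⁻¹' (B ∩ Δ 0)) := by
    rw [Measure.restrict_apply (hFm hB), Measure.restrict_apply (hFm hA)]
    congr 1
    ext p
    simp only [mem_inter_iff, mem_preimage]
    exact ⟨fun h => ⟨⟨h.1, hT.returnMap_mem hF h.2⟩, h.2⟩, fun h => ⟨h.1.1, h.2⟩⟩
  rw [h1, hT.measure_preimage_returnMap hΔ hS.measurable hF h0 hA]
  refine tsum_congr fun k => ?_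
  rw [Measure.restrict_apply (hS.measurable (measurableSet_towerLift hS.measurable hΔ 0 k hA))]

end IsTower

/-- The measure on the tower obtained by spreading a measure `μ` on the base along the orbits
until the first return. -/
def towerMeasure [MeasurableSpace Ω] (S : Ω → Ω) (Δ : ℕ → Set Ω) (μ : Measure Ω) : Measure Ω :=
  Measure.sum fun k => (μ.restrict (S ⁻¹' ⋃ j, Δ (j + k))).map S^[k + 1]

namespace IsTower

variable [MeasurableSpace Ω] {μ : Measure Ω}

theorem towerMeasure_apply (hS : Measurable S) {B : Set Ω} (hB : MeasurableSet B) :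
    towerMeasure S Δ μ B = ∑' k, μ (S ⁻¹' ((⋃ j, Δ (j + k)) ∩ S^[k] ⁻¹' B)) := by
  rw [towerMeasure, Measure.sum_apply _ hB]
  refine tsum_congr fun k => ?_
  rw [Measure.map_apply (hS.iterate _) hB, Measure.restrict_apply ((hS.iterate _) hB),
    preimage_inter, inter_comm, Function.iterate_succ, preimage_comp]

theorem towerMeasure_apply_of_subset (hT : IsTower S Δ) (hS : Measurable S) {n : ℕ} {A : Set Ω}
    (hA : A ⊆ Δ n) (hAm : MeasurableSet A) :
    towerMeasure S Δ μ A = ∑' k, μ (S ⁻¹' towerLift S Δ n k A) := by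
  rw [towerMeasure_apply hS hAm]
  exact tsum_congr fun k => by rw [hT.iUnion_ge_inter_preimage k hA]

theorem towerMeasure_univ (hS : Measurable S) :
    towerMeasure S Δ μ univ = ∑' k, μ (S ⁻¹' ⋃ j, Δ (j + k)) := by
  rw [towerMeasure_apply hS MeasurableSet.univ]
  simp

theorem towerMeasure_compl (hT : IsTower S Δ) (hΔ : ∀ n, MeasurableSet (Δ n))
    (hS : Measurable S) : towerMeasure S Δ μ (⋃ n, Δ n)ᶜ = 0 := by
  rw [towerMeasure_apply hS (MeasurableSet.iUnion hΔ).compl, ENNReal.tsum_eq_zero]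
  intro k
  convert measure_empty (μ := μ)
  rw [eq_empty_iff_forall_notMem]
  rintro p ⟨h, h'⟩
  obtain ⟨j, hj⟩ := mem_iUnion.1 h
  exact h' (mem_iUnion.2 ⟨j, hT.iterate_mem j k hj⟩)

theorem towerMeasure_level_ne_top (hT : IsTower S Δ) (hΔ : ∀ n, MeasurableSet (Δ n))
    (hS : Measurable S) [IsFiniteMeasure μ] (n : ℕ) : towerMeasure S Δ μ (Δ n) ≠ ⊤ := by
  rw [hT.towerMeasure_apply_of_subset hS subset_rfl (hΔ n), ← measure_iUnion]
  · exact measure_ne_top _ _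
  · intro k l hkl
    rw [Function.onFun, hT.towerLift_self, hT.towerLift_self]
    exact (hT.pairwise_disjoint (by omega)).preimage S
  · exact fun k => hS (measurableSet_towerLift hS hΔ n k (hΔ n))

theorem sigmaFinite_towerMeasure (hT : IsTower S Δ) (hΔ : ∀ n, MeasurableSet (Δ n))
    (hS : Measurable S) [IsFiniteMeasure μ] : SigmaFinite (towerMeasure S Δ μ) := by
  refine ⟨⟨⟨fun n => Δ n ∪ (⋃ n, Δ n)ᶜ, fun _ => trivial, fun n => ?_, ?_⟩⟩⟩
  · refine (measure_union_le _ _).trans_lt ?_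
    rw [hT.towerMeasure_compl hΔ hS, add_zero]
    exact (hT.towerMeasure_level_ne_top hΔ hS n).lt_top
  · rw [← iUnion_union, union_compl_self]

theorem towerMeasure_absolutelyContinuous {m : Measure Ω}
    (hS : Measure.QuasiMeasurePreserving S m m) (hμ : μ ≪ m) : towerMeasure S Δ μ ≪ m := by
  refine Measure.AbsolutelyContinuous.mk fun B hB h0 => ?_
  rw [towerMeasure, Measure.sum_apply _ hB, ENNReal.tsum_eq_zero]
  intro k
  rw [Measure.map_apply (hS.measurable.iterate _) hB]
  exact Measure.absolutelyContinuous_of_le Measure.restrict_le_self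
    (hμ ((hS.iterate _).preimage_null h0))

theorem towerMeasure_restrict_base (hT : IsTower S Δ) (hΔ : ∀ n, MeasurableSet (Δ n))
    (hS : Measurable S) (hF : IsReturnMap S Δ F) (hμ : μ (Δ 0)ᶜ = 0)
    (hFμ : MeasurePreserving F μ μ) : (towerMeasure S Δ μ).restrict (Δ 0) = μ := by
  refine Measure.ext fun B hB => ?_
  have hA := hB.inter (hΔ 0)
  rw [Measure.restrict_apply hB, hT.towerMeasure_apply_of_subset hS inter_subset_right hA,
    ← hT.measure_preimage_returnMap hΔ hS hF hμ hA, hFμ.measure_preimage hA.nullMeasurableSet,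
    measure_inter_conull hμ]

/-- Spreading a measure invariant under the return map gives an invariant measure. -/
theorem measurePreserving_towerMeasure (hT : IsTower S Δ) (hΔ : ∀ n, MeasurableSet (Δ n))
    (hS : Measurable S) (hF : IsReturnMap S Δ F) (hμ : μ (Δ 0)ᶜ = 0)
    (hFμ : MeasurePreserving F μ μ) :
    MeasurePreserving S (towerMeasure S Δ μ) (towerMeasure S Δ μ) := by
  set ν := towerMeasure S Δ μ with hνdef
  have hν : ν (⋃ n, Δ n)ᶜ = 0 := hT.towerMeasure_compl hΔ hS
  have hlevel : ∀ n A, A ⊆ Δ n → MeasurableSet A → ν (S ⁻¹' A) = ν A := by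
    intro n A hA hAm
    rw [hT.measure_eq_of_subset_level hΔ hS hν hA hAm, ← Measure.restrict_apply (hS hAm),
      hT.towerMeasure_restrict_base hΔ hS hF hμ hFμ,
      hT.towerMeasure_apply_of_subset hS inter_subset_right ((hS hAm).inter (hΔ _)),
      hT.towerMeasure_apply_of_subset hS hA hAm,
      tsum_eq_zero_add' (f := fun k => μ (S ⁻¹' towerLift S Δ n k A)) ENNReal.summable,
      towerLift_zero hA]
    congr 1
    exact tsum_congr fun k => by rw [towerLift_preimage n k A hT]
  refine ⟨hS, Measure.ext fun B hB => ?_⟩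
  rw [Measure.map_apply hS hB, hT.measure_eq_tsum hΔ hν hB]
  have hU : S ⁻¹' B ∩ ⋃ n, Δ n ⊆ ⋃ n, S ⁻¹' (B ∩ Δ n) := by
    rintro p ⟨hp, hp'⟩
    obtain ⟨m, hm⟩ := mem_iUnion.1 hp'
    rcases m with _ | m
    · obtain ⟨k, hk⟩ := mem_iUnion.1 (hT.mapsTo_zero hm)
      exact mem_iUnion.2 ⟨k, hp, hk⟩
    · exact mem_iUnion.2 ⟨m, hp, hT.mapsTo_succ m hm⟩
  have h1 : ν (S ⁻¹' B) = ν (⋃ n, S ⁻¹' (B ∩ Δ n)) := by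
    refine le_antisymm ?_ (measure_mono (iUnion_subset fun n => preimage_mono inter_subset_left))
    rw [← measure_inter_conull hν]
    exact measure_mono hU
  rw [h1, measure_iUnion _ fun n => hS (hB.inter (hΔ n))]
  · exact tsum_congr fun n => hlevel n _ inter_subset_right (hB.inter (hΔ n))
  · intro m n hmn
    exact ((hT.pairwise_disjoint hmn).mono inter_subset_right inter_subset_right).preimage S

end IsTower

end Tower

section ContractingBranches

variable {Y ι : Type*} [PseudoEMetricSpace Y] [MeasurableSpace Y]

/-- `μ` is a stationary probability measure for the contracting inverse branches `ψ i`, taken with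
probabilities `w i`, of the map `F`. -/
structure IsContractingBranchSystem (F : Y → Y) (μ : Measure Y) (E : Set Y)
    (w : ι → ENNReal) (ψ : ι → Y → Y) (q : ENNReal) : Prop where
  lt_one : q < 1
  conull : μ Eᶜ = 0
  measurable : ∀ i, Measurable (ψ i)
  mapsTo : ∀ i, MapsTo (ψ i) E E
  edist_le : ∀ i, ∀ x ∈ E, ∀ y ∈ E, edist (ψ i x) (ψ i y) ≤ q * edist x y
  rightInv : ∀ i, ∀ x ∈ E, F (ψ i x) = x
  lintegral_eq : ∀ g : Y → ENNReal, Measurable g →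
    ∫⁻ x, g x ∂μ = ∑' i, w i * ∫⁻ x, g (ψ i x) ∂μ

namespace IsContractingBranchSystem

variable {F : Y → Y} {μ : Measure Y} {E : Set Y} {w : ι → ENNReal} {ψ : ι → Y → Y} {q : ENNReal}

theorem tsum_eq_one [IsProbabilityMeasure μ] (h : IsContractingBranchSystem F μ E w ψ q) :
    ∑' i, w i = 1 := by
  simpa using (h.lintegral_eq (fun _ => 1) measurable_const).symm

theorem ae_mem (h : IsContractingBranchSystem F μ E w ψ q) : ∀ᵐ x ∂μ, x ∈ E :=
  h.conull

theorem measurePreserving [IsProbabilityMeasure μ] (h : IsContractingBranchSystem F μ E w ψ q)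
    (hF : Measurable F) : MeasurePreserving F μ μ := by
  refine ⟨hF, Measure.ext fun B hB => ?_⟩
  rw [Measure.map_apply hF hB, ← lintegral_indicator_one (hF hB),
    h.lintegral_eq _ (measurable_one.indicator (hF hB))]
  have : ∀ i, ∫⁻ x, (F ⁻¹' B).indicator (1 : Y → ENNReal) (ψ i x) ∂μ = μ B := by
    intro i
    rw [← lintegral_indicator_one hB]
    refine lintegral_congr_ae (h.ae_mem.mono fun x hx => ?_)
    have hiff : ψ i x ∈ F ⁻¹' B ↔ x ∈ B := by rw [mem_preimage, h.rightInv i x hx]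
    by_cases hxB : x ∈ B
    · simp [indicator_of_mem hxB, indicator_of_mem (hiff.2 hxB)]
    · simp [indicator_of_notMem hxB, indicator_of_notMem (mt hiff.1 hxB)]
  simp_rw [this, ENNReal.tsum_mul_right, h.tsum_eq_one, one_mul]

theorem setLIntegral_le [Countable ι] [IsProbabilityMeasure μ]
    (h : IsContractingBranchSystem F μ E w ψ q)
    {D : ENNReal} (hD : ∀ x ∈ E, ∀ y ∈ E, edist x y ≤ D) {A : Set Y} (hA : MeasurableSet A)
    (hFA : F ⁻¹' A = A) (k : ℕ) {K : ENNReal} {g : Y → ENNReal} (hg : Measurable g)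
    (hK : ∀ x ∈ E, ∀ y ∈ E, g x ≤ g y + K * edist x y) :
    ∫⁻ x in A, g x ∂μ ≤ μ A * (∫⁻ x, g x ∂μ + q ^ k * K * D) := by
  induction k generalizing K g with
  | zero =>
    have hle : ∀ x ∈ E, g x ≤ ∫⁻ y, g y ∂μ + K * D := by
      intro x hx
      calc g x = ∫⁻ _, g x ∂μ := by simp
        _ ≤ ∫⁻ y, (g y + K * D) ∂μ := by
          refine lintegral_mono_ae (h.ae_mem.mono fun y hy => ?_)
          exact (hK x hx y hy).trans (by gcongr; exact hD x hx y hy)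
        _ = _ := by rw [lintegral_add_right _ measurable_const]; simp
    calc ∫⁻ x in A, g x ∂μ ≤ ∫⁻ _ in A, (∫⁻ y, g y ∂μ + K * D) ∂μ :=
          lintegral_mono_ae (ae_restrict_of_ae (h.ae_mem.mono hle))
      _ = _ := by simp [mul_comm]
  | succ k ih =>
    have hm : ∀ i, Measurable fun x => w i * g (ψ i x) := fun i =>
      (hg.comp (h.measurable i)).const_mul _
    have hLm : Measurable fun x => ∑' i, w i * g (ψ i x) := Measurable.tsum hm
    have h1 : ∫⁻ x, g x ∂μ = ∫⁻ x, ∑' i, w i * g (ψ i x) ∂μ := by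
      rw [h.lintegral_eq g hg, lintegral_tsum fun i => (hm i).aemeasurable]
      exact tsum_congr fun i => (lintegral_const_mul _ (hg.comp (h.measurable i))).symm
    have h2 : ∫⁻ x in A, g x ∂μ = ∫⁻ x in A, ∑' i, w i * g (ψ i x) ∂μ := by
      rw [← lintegral_indicator hA, h.lintegral_eq _ (hg.indicator hA),
        lintegral_tsum fun i => (hm i).aemeasurable]
      refine tsum_congr fun i => ?_
      rw [lintegral_const_mul _ (show Measurable fun x => g (ψ i x) from
        hg.comp (h.measurable i)), ← lintegral_indicator hA]
      congr 1
      refine lintegral_congr_ae (h.ae_mem.mono fun x hx => ?_)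
      have hiff : ψ i x ∈ A ↔ x ∈ A := by
        rw [← h.rightInv i x hx, ← mem_preimage (f := F), hFA, h.rightInv i x hx]
      by_cases hxA : x ∈ A
      · simp [indicator_of_mem hxA, indicator_of_mem (hiff.2 hxA)]
      · simp [indicator_of_notMem hxA, indicator_of_notMem (mt hiff.1 hxA)]
    rw [h1, h2, show q ^ (k + 1) * K * D = q ^ k * (q * K) * D by ring]
    refine ih hLm fun x hx y hy => ?_
    calc ∑' i, w i * g (ψ i x)
        ≤ ∑' i, (w i * g (ψ i y) + w i * (q * K * edist x y)) := by
          refine ENNReal.tsum_le_tsum fun i => ?_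
          rw [← mul_add]
          gcongr
          refine (hK _ (h.mapsTo i hx) _ (h.mapsTo i hy)).trans ?_
          rw [mul_comm q K, mul_assoc]
          gcongr
          exact h.edist_le i x hx y hy
      _ = _ := by rw [ENNReal.tsum_add, ENNReal.tsum_mul_right, h.tsum_eq_one, one_mul]

/-- Decorrelation of an invariant set from all Lipschitz observables. -/
theorem setLIntegral_le_mul [Countable ι] [IsProbabilityMeasure μ]
    (h : IsContractingBranchSystem F μ E w ψ q)
    {D : ENNReal} (hDt : D ≠ ⊤) (hD : ∀ x ∈ E, ∀ y ∈ E, edist x y ≤ D) {A : Set Y}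
    (hA : MeasurableSet A) (hFA : F ⁻¹' A = A) {K : ENNReal} (hKt : K ≠ ⊤) {g : Y → ENNReal}
    (hg : Measurable g) (hK : ∀ x ∈ E, ∀ y ∈ E, g x ≤ g y + K * edist x y) :
    ∫⁻ x in A, g x ∂μ ≤ μ A * ∫⁻ x, g x ∂μ := by
  have h0 : Tendsto (fun k : ℕ => q ^ k * K * D) atTop (𝓝 0) := by
    have := ENNReal.Tendsto.mul_const (ENNReal.Tendsto.mul_const
      (ENNReal.tendsto_pow_atTop_nhds_zero_of_lt_one h.lt_one) (Or.inr hKt)) (b := D) (Or.inr hDt)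
    simpa using this
  have h1 : Tendsto (fun k : ℕ => μ A * (∫⁻ x, g x ∂μ + q ^ k * K * D)) atTop
      (𝓝 (μ A * (∫⁻ x, g x ∂μ + 0))) :=
    ENNReal.Tendsto.const_mul (tendsto_const_nhds.add h0) (Or.inr (measure_ne_top _ _))
  rw [add_zero] at h1
  exact ge_of_tendsto' h1 fun k => h.setLIntegral_le hD hA hFA k hg hK

theorem measure_inter_le_mul [Countable ι] [BorelSpace Y] [IsProbabilityMeasure μ]
    (h : IsContractingBranchSystem F μ E w ψ q)
    {D : ENNReal} (hDt : D ≠ ⊤) (hD : ∀ x ∈ E, ∀ y ∈ E, edist x y ≤ D) {A : Set Y}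
    (hA : MeasurableSet A) (hFA : F ⁻¹' A = A) {C : Set Y} (hC : IsClosed C) :
    μ (A ∩ C) ≤ μ A * μ C := by
  have key : ∀ δ : ℝ, 0 < δ → μ (A ∩ C) ≤ μ A * μ (Metric.cthickening δ C) := by
    intro δ hδ
    have hδ0 : ENNReal.ofReal δ ≠ 0 := by simpa using hδ
    have hgm : Measurable fun x => 1 - Metric.infEDist x C / ENNReal.ofReal δ :=
      measurable_const.sub (measurable_infEDist.div_const _)
    have hlip : ∀ x ∈ E, ∀ y ∈ E, 1 - Metric.infEDist x C / ENNReal.ofReal δ ≤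
        1 - Metric.infEDist y C / ENNReal.ofReal δ + (ENNReal.ofReal δ)⁻¹ * edist x y := by
      intro x _ y _
      rw [tsub_le_iff_right]
      have h1 : Metric.infEDist y C / ENNReal.ofReal δ ≤
          (ENNReal.ofReal δ)⁻¹ * edist x y + Metric.infEDist x C / ENNReal.ofReal δ := by
        rw [ENNReal.div_eq_inv_mul, ENNReal.div_eq_inv_mul, ← mul_add]
        gcongr
        rw [add_comm, edist_comm]
        exact Metric.infEDist_le_infEDist_add_edist
      calc (1 : ENNReal) ≤ 1 - Metric.infEDist y C / ENNReal.ofReal δ +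
            Metric.infEDist y C / ENNReal.ofReal δ := le_tsub_add
        _ ≤ _ := by rw [add_assoc]; gcongr
    calc μ (A ∩ C) = ∫⁻ x in A, C.indicator 1 x ∂μ := by
          rw [lintegral_indicator_one hC.measurableSet, Measure.restrict_apply hC.measurableSet,
            inter_comm]
      _ ≤ ∫⁻ x in A, (1 - Metric.infEDist x C / ENNReal.ofReal δ) ∂μ := by
          refine lintegral_mono fun x => ?_
          by_cases hx : x ∈ C
          · simp [hx, Metric.infEDist_zero_of_mem hx]
          · simp [hx]
      _ ≤ μ A * ∫⁻ x, (1 - Metric.infEDist x C / ENNReal.ofReal δ) ∂μ :=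
          h.setLIntegral_le_mul hDt hD hA hFA (ENNReal.inv_ne_top.2 hδ0) hgm hlip
      _ ≤ μ A * ∫⁻ x, (Metric.cthickening δ C).indicator 1 x ∂μ := by
          gcongr with x
          by_cases hx : x ∈ Metric.cthickening δ C
          · simp [hx]
          · simp only [hx, not_false_eq_true, indicator_of_notMem, nonpos_iff_eq_zero]
            rw [Metric.mem_cthickening_iff, not_le] at hx
            rw [tsub_eq_zero_iff_le, ENNReal.le_div_iff_mul_le (Or.inl hδ0) (Or.inl (by simp)),
              one_mul]
            exact hx.le
      _ = _ := by rw [lintegral_indicator_one Metric.isClosed_cthickening.measurableSet]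
  have hlim := tendsto_measure_cthickening_of_isClosed (μ := μ)
    ⟨1, one_pos, measure_ne_top _ _⟩ hC
  have hlim' := ENNReal.Tendsto.const_mul (a := μ A)
    (hlim.mono_left (nhdsWithin_le_nhds (s := Ioi 0))) (Or.inr (measure_ne_top _ _))
  exact ge_of_tendsto hlim' (eventually_nhdsWithin_of_forall key)

theorem ergodic [Countable ι] [BorelSpace Y] [IsProbabilityMeasure μ] [μ.WeaklyRegular]
    (h : IsContractingBranchSystem F μ E w ψ q) (hF : Measurable F)
    {D : ENNReal} (hDt : D ≠ ⊤) (hD : ∀ x ∈ E, ∀ y ∈ E, edist x y ≤ D) : Ergodic F μ := by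
  refine ⟨h.measurePreserving hF, ⟨fun A hA hFA => ?_⟩⟩
  have hle : μ A ≤ μ A * μ A := by
    conv_lhs => rw [hA.measure_eq_iSup_isClosed_of_ne_top (measure_ne_top _ _)]
    refine iSup_le fun C => iSup_le fun hCA => iSup_le fun hC => ?_
    calc μ C = μ (A ∩ C) := by rw [inter_eq_right.2 hCA]
      _ ≤ μ A * μ C := h.measure_inter_le_mul hDt hD hA hFA hC
      _ ≤ _ := by gcongr
  rw [eventuallyConst_set']
  by_cases h0 : μ A = 0
  · exact Or.inl (ae_eq_empty.2 h0)
  · refine Or.inr (ae_eq_univ.2 ?_)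
    rw [prob_compl_eq_zero_iff hA]
    refine le_antisymm prob_le_one ?_
    rwa [← ENNReal.mul_le_mul_iff_right h0 (measure_ne_top μ A), mul_one]

end IsContractingBranchSystem

end ContractingBranches

section Preimages

theorem lsv_of_le {a x : ℝ} (h0 : 0 ≤ x) (h : x ≤ 1 / 2) : lsv a x = x * (1 + (2 * x) ^ a) := by
  rw [lsv, if_pos h, Real.mul_rpow two_pos.le h0]

theorem lsv_half (a : ℝ) : lsv a (1 / 2) = 1 := by
  rw [lsv_of_le (by norm_num) le_rfl]
  norm_num

theorem lsv_strictMonoOn {a : ℝ} (ha : 0 < a) : StrictMonoOn (lsv a) (Icc 0 (1 / 2)) := by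
  intro x hx y hy hxy
  rw [lsv_of_le hx.1 hx.2, lsv_of_le hy.1 hy.2]
  have h2x : 0 ≤ 2 * x := mul_nonneg two_pos.le hx.1
  have := Real.rpow_lt_rpow h2x (by linarith : 2 * x < 2 * y) ha
  exact mul_lt_mul'' hxy (by linarith) hx.1 (by positivity)

/-- The sequence `X` of random preimages of `1/2` under the left branches of the random LSV maps
with parameters `1 ≤ α < β`. -/
structure IsRandomPreimages (α β p₁ : ℝ) (X : ℕ → ℝ → ℝ) : Prop where
  one_le : 1 ≤ α
  lt : α < β
  pos : 0 < p₁
  lt_one : p₁ < 1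
  zero : ∀ ω, X 0 ω = 1
  one : ∀ ω, X 1 ω = 1 / 2
  mem : ∀ n ω, X (n + 2) ω ∈ Ioc (0 : ℝ) (1 / 2)
  map : ∀ n ω, lsv (alphaOf α β p₁ ω) (X (n + 2) ω) = X (n + 1) (phiMap p₁ ω)

namespace IsRandomPreimages

variable {α β p₁ : ℝ} {X : ℕ → ℝ → ℝ}

theorem one_le_alphaOf (h : IsRandomPreimages α β p₁ X) (ω : ℝ) : 1 ≤ alphaOf α β p₁ ω := by
  have := h.one_le
  have := h.lt
  unfold alphaOf
  split_ifs <;> linarith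

theorem alphaOf_le (h : IsRandomPreimages α β p₁ X) (ω : ℝ) : alphaOf α β p₁ ω ≤ β := by
  have := h.lt
  unfold alphaOf
  split_ifs <;> linarith

theorem lsv_strictMonoOn (h : IsRandomPreimages α β p₁ X) (ω : ℝ) :
    StrictMonoOn (lsv (alphaOf α β p₁ ω)) (Icc 0 (1 / 2)) :=
  _root_.lsv_strictMonoOn (by linarith [h.one_le_alphaOf ω])

theorem succ_mem (h : IsRandomPreimages α β p₁ X) (n : ℕ) (ω : ℝ) :
    X (n + 1) ω ∈ Ioc (0 : ℝ) (1 / 2) := by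
  cases n with
  | zero => rw [zero_add, h.one]; norm_num
  | succ n => exact h.mem n ω

theorem succ_mem_Icc (h : IsRandomPreimages α β p₁ X) (n : ℕ) (ω : ℝ) :
    X (n + 1) ω ∈ Icc (0 : ℝ) (1 / 2) :=
  Ioc_subset_Icc_self (h.succ_mem n ω)

theorem X_pos (h : IsRandomPreimages α β p₁ X) (n : ℕ) (ω : ℝ) : 0 < X n ω := by
  cases n with
  | zero => rw [h.zero]; norm_num
  | succ n => exact (h.succ_mem n ω).1

theorem succ_lt (h : IsRandomPreimages α β p₁ X) (n : ℕ) (ω : ℝ) : X (n + 1) ω < X n ω := by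
  induction n generalizing ω with
  | zero => rw [zero_add, h.zero, h.one]; norm_num
  | succ n ih =>
    rw [← (h.lsv_strictMonoOn ω).lt_iff_lt (h.succ_mem_Icc (n + 1) ω) (h.succ_mem_Icc n ω), h.map]
    cases n with
    | zero => rw [zero_add, h.one, h.one, lsv_half]; norm_num
    | succ n => rw [h.map]; exact ih _

theorem antitone (h : IsRandomPreimages α β p₁ X) (ω : ℝ) : Antitone fun n => X n ω :=
  antitone_nat_of_succ_le fun n => (h.succ_lt n ω).le

theorem le_one (h : IsRandomPreimages α β p₁ X) (n : ℕ) (ω : ℝ) : X n ω ≤ 1 := by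
  rw [← h.zero ω]
  exact h.antitone ω (Nat.zero_le n)

theorem inv_le (h : IsRandomPreimages α β p₁ X) (n : ℕ) (ω : ℝ) :
    1 / (2 * ((n : ℝ) + 1)) ≤ X (n + 1) ω := by
  induction n generalizing ω with
  | zero => rw [zero_add, h.one]; norm_num
  | succ n ih =>
    by_contra! hlt
    obtain ⟨h0, h1⟩ := h.mem n ω
    have h2 := ih (phiMap p₁ ω)
    rw [← h.map, lsv_of_le h0.le h1] at h2
    have h3 : (2 * X (n + 2) ω) ^ alphaOf α β p₁ ω ≤ 2 * X (n + 2) ω :=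
      Real.rpow_le_self_of_le_one (by linarith) (by linarith) (h.one_le_alphaOf ω)
    set x := X (n + 2) ω
    push_cast at hlt
    set m : ℝ := (n : ℝ) + 1 with hm
    have hm0 : 0 < m := by positivity
    have h4 : 1 / (2 * m) ≤ x * (1 + 2 * x) := h2.trans (by gcongr)
    have h5 : x * (1 + 2 * x) < 1 / (2 * (m + 1)) * (1 + 2 * (1 / (2 * (m + 1)))) := by
      refine mul_lt_mul'' hlt (by linarith) h0.le (by positivity)
    have h6 : 1 / (2 * (m + 1)) * (1 + 2 * (1 / (2 * (m + 1)))) < 1 / (2 * m) := by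
      rw [← sub_pos]
      have : 1 / (2 * m) - 1 / (2 * (m + 1)) * (1 + 2 * (1 / (2 * (m + 1)))) =
          1 / (2 * m * (m + 1) ^ 2) := by
        field_simp
        ring
      rw [this]
      positivity
    linarith

theorem mul_pow_le (h : IsRandomPreimages α β p₁ X) {c : ℝ} (hc : 0 < c) (n : ℕ) (ω : ℝ)
    (hX : c < X (n + 1) ω) : X (n + 1) ω * (1 + (2 * c) ^ β) ^ n ≤ 1 / 2 := by
  induction n generalizing ω with
  | zero => rw [zero_add, h.one]; norm_num
  | succ n ih =>
    obtain ⟨h0, h1⟩ := h.mem n ω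
    have h2 := h.map n ω
    rw [lsv_of_le h0.le h1] at h2
    have h3 : (2 * c) ^ β ≤ (2 * X (n + 2) ω) ^ alphaOf α β p₁ ω :=
      (Real.rpow_le_rpow_of_exponent_ge (by linarith) (by linarith) (h.alphaOf_le ω)).trans
        (Real.rpow_le_rpow (by linarith) (by linarith) (by linarith [h.one_le_alphaOf ω]))
    have h4 : X (n + 2) ω * (1 + (2 * c) ^ β) ≤ X (n + 1) (phiMap p₁ ω) := by
      rw [← h2]
      gcongr
    have h5 : 0 < (2 * c) ^ β := by positivity
    have h6 : X (n + 2) ω ≤ X (n + 2) ω * (1 + (2 * c) ^ β) := by nlinarith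
    calc X (n + 2) ω * (1 + (2 * c) ^ β) ^ (n + 1)
        = X (n + 2) ω * (1 + (2 * c) ^ β) * (1 + (2 * c) ^ β) ^ n := by ring
      _ ≤ X (n + 1) (phiMap p₁ ω) * (1 + (2 * c) ^ β) ^ n := by gcongr
      _ ≤ 1 / 2 := ih _ (by linarith)

theorem exists_lt (h : IsRandomPreimages α β p₁ X) {x : ℝ} (hx : 0 < x) (ω : ℝ) :
    ∃ n, X (n + 1) ω < x := by
  have h1 : 1 < 1 + (2 * (x / 2)) ^ β := by
    have : 0 < (2 * (x / 2)) ^ β := by positivity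
    linarith
  obtain ⟨n, hn⟩ := pow_unbounded_of_one_lt (1 / x) h1
  refine ⟨n, ?_⟩
  by_contra! hle
  have h2 := h.mul_pow_le (half_pos hx) n ω (by linarith)
  have h3 : x * (1 / x) < X (n + 1) ω * (1 + (2 * (x / 2)) ^ β) ^ n :=
    mul_lt_mul' hle hn (by positivity) (h.X_pos _ ω)
  rw [mul_one_div_cancel hx.ne'] at h3
  linarith

theorem exists_mem_Ioc (h : IsRandomPreimages α β p₁ X) {x : ℝ} (hx : x ∈ Ioc (0 : ℝ) 1) (ω : ℝ) :
    ∃ n, x ∈ Ioc (X (n + 1) ω) (X n ω) := by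
  classical
  have hex := h.exists_lt hx.1 ω
  refine ⟨Nat.find hex, Nat.find_spec hex, ?_⟩
  rcases hn : Nat.find hex with _ | m
  · rw [h.zero]
    exact hx.2
  · exact not_lt.1 (Nat.find_min hex (by omega : m < Nat.find hex))

theorem iUnion_Ioc (h : IsRandomPreimages α β p₁ X) (ω : ℝ) :
    ⋃ n, Ioc (X (n + 1) ω) (X n ω) = Ioc (0 : ℝ) 1 := by
  refine Subset.antisymm (iUnion_subset fun n => ?_) fun x hx =>
    mem_iUnion.2 (h.exists_mem_Ioc hx ω)
  exact Ioc_subset_Ioc (h.X_pos _ ω).le (h.le_one n ω)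

theorem pairwise_disjoint_Ioc (h : IsRandomPreimages α β p₁ X) (ω : ℝ) :
    Pairwise (Function.onFun Disjoint fun n => Ioc (X (n + 1) ω) (X n ω)) :=
  (h.antitone ω).pairwise_disjoint_on_Ioc_succ

end IsRandomPreimages

theorem measurable_phiMap (p₁ : ℝ) : Measurable (phiMap p₁) :=
  Measurable.ite measurableSet_Iio (measurable_id.div_const _)
    ((measurable_id.sub_const _).div_const _)

theorem IsRandomPreimages.measurable {α β p₁ : ℝ} {X : ℕ → ℝ → ℝ}
    (h : IsRandomPreimages α β p₁ X) (n : ℕ) : Measurable (X n) := by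
  rcases n with _ | n
  · rw [show X 0 = fun _ => 1 from funext h.zero]
    exact measurable_const
  induction n with
  | zero =>
    rw [show X (0 + 1) = fun _ => 1 / 2 from funext h.one]
    exact measurable_const
  | succ n ih =>
    refine measurable_of_Iio fun c => ?_
    by_cases hc : c ∈ Icc (0 : ℝ) (1 / 2)
    · have : X (n + 1 + 1) ⁻¹' Iio c =
          {ω | X (n + 1) (phiMap p₁ ω) < lsv (alphaOf α β p₁ ω) c} := by
        ext ω
        simp only [mem_preimage, mem_Iio, mem_ofPred_eq]
        rw [← h.map, (h.lsv_strictMonoOn ω).lt_iff_lt (h.succ_mem_Icc _ ω) hc]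
      rw [this]
      refine measurableSet_lt (ih.comp (measurable_phiMap p₁)) ?_
      have : (fun ω => lsv (alphaOf α β p₁ ω) c) =
          fun ω => if ω < p₁ then lsv α c else lsv β c := by
        funext ω
        unfold alphaOf
        split_ifs <;> rfl
      rw [this]
      exact Measurable.ite measurableSet_Iio measurable_const measurable_const
    · rw [mem_Icc, not_and_or, not_le, not_le] at hc
      rcases hc with hc | hc
      · convert MeasurableSet.empty
        rw [eq_empty_iff_forall_notMem]
        intro ω hω
        exact absurd (h.X_pos (n + 2) ω) (not_lt.2 ((mem_Iio.1 hω).trans hc).le)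
      · convert MeasurableSet.univ
        rw [eq_univ_iff_forall]
        intro ω
        exact (h.mem n ω).2.trans_lt hc

end Preimages

section Nonsingular

theorem measurable_of_forall_eqOn {Y Z ι : Type*} [MeasurableSpace Y] [MeasurableSpace Z]
    [Countable ι] {D : ι → Set Y} (hD : ∀ i, MeasurableSet (D i)) (hcover : ∀ y, ∃ i, y ∈ D i)
    {f : Y → Z} {g : ι → Y → Z} (hg : ∀ i, Measurable (g i)) (hfg : ∀ i, EqOn f (g i) (D i)) :
    Measurable f := by
  intro B hB
  have : f ⁻¹' B = ⋃ i, (D i ∩ g i ⁻¹' B) := by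
    ext y
    simp only [mem_preimage, mem_iUnion, mem_inter_iff]
    constructor
    · intro hy
      obtain ⟨i, hi⟩ := hcover y
      exact ⟨i, hi, hfg i hi ▸ hy⟩
    · rintro ⟨i, hi, hy⟩
      rw [hfg i hi]
      exact hy
  rw [this]
  exact MeasurableSet.iUnion fun i => (hD i).inter (hg i hB)

theorem quasiMeasurePreserving_of_forall_eqOn {Y Z ι : Type*} [MeasurableSpace Y]
    [MeasurableSpace Z] [Countable ι] {μ : Measure Y} {ν : Measure Z} {D : ι → Set Y}
    (hD : ∀ i, MeasurableSet (D i)) (hcover : ∀ y, ∃ i, y ∈ D i)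
    {f : Y → Z} {g : ι → Y → Z} (hg : ∀ i, Measure.QuasiMeasurePreserving (g i) μ ν)
    (hfg : ∀ i, EqOn f (g i) (D i)) : Measure.QuasiMeasurePreserving f μ ν := by
  have hf := measurable_of_forall_eqOn hD hcover (fun i => (hg i).measurable) hfg
  refine ⟨hf, Measure.AbsolutelyContinuous.mk fun B hB h0 => ?_⟩
  rw [Measure.map_apply hf hB]
  refine measure_mono_null (t := ⋃ i, g i ⁻¹' B) (fun y hy => ?_)
    (measure_iUnion_null fun i => (hg i).preimage_null h0)
  obtain ⟨i, hi⟩ := hcover y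
  exact mem_iUnion.2 ⟨i, by rw [mem_preimage, ← hfg i hi]; exact hy⟩

theorem quasiMeasurePreserving_affine {c : ℝ} (hc : c ≠ 0) (d : ℝ) :
    Measure.QuasiMeasurePreserving (fun x : ℝ => c * x + d) volume volume := by
  have h1 : Measure.QuasiMeasurePreserving (fun x : ℝ => c * x) volume volume := by
    refine ⟨measurable_const_mul c, ?_⟩
    rw [Real.map_volume_mul_left hc]
    exact Measure.smul_absolutelyContinuous
  exact (measurePreserving_add_right volume d).quasiMeasurePreserving.comp h1

theorem quasiMeasurePreserving_phiMap {p₁ : ℝ} (h0 : 0 < p₁) (h1 : p₁ < 1) :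
    Measure.QuasiMeasurePreserving (phiMap p₁) volume volume := by
  refine quasiMeasurePreserving_of_forall_eqOn (ι := Bool)
    (D := fun b => cond b (Iio p₁) (Ici p₁))
    (g := fun b => cond b (fun x => p₁⁻¹ * x + 0) fun x => (1 - p₁)⁻¹ * x + -p₁ * (1 - p₁)⁻¹)
    ?_ ?_ ?_ ?_
  · rintro (_ | _)
    exacts [measurableSet_Ici, measurableSet_Iio]
  · intro y
    rcases lt_or_ge y p₁ with h | h
    exacts [⟨true, h⟩, ⟨false, h⟩]
  · rintro (_ | _)
    exacts [quasiMeasurePreserving_affine (inv_ne_zero (by linarith)) _,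
      quasiMeasurePreserving_affine (inv_ne_zero h0.ne') _]
  · rintro (_ | _) x hx
    · simp only [cond_false, mem_Ici] at hx
      simp only [phiMap, not_lt.2 hx, if_false, cond_false]
      ring
    · simp only [cond_true, mem_Iio] at hx
      simp only [phiMap, hx, if_true, cond_true]
      ring

/-- A skew product with fibrewise affine, nondegenerate maps over a nonsingular base map is
nonsingular. -/
theorem quasiMeasurePreserving_skew_affine {c d φ : ℝ → ℝ} (hc : Measurable c) (hd : Measurable d)
    (hc0 : ∀ ω, c ω ≠ 0) (hφ : Measure.QuasiMeasurePreserving φ volume volume) :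
    Measure.QuasiMeasurePreserving (fun p : ℝ × ℝ => (c p.2 * p.1 + d p.2, φ p.2))
      volume volume := by
  have hm : Measurable fun p : ℝ × ℝ => (c p.2 * p.1 + d p.2, φ p.2) :=
    (((hc.comp measurable_snd).mul measurable_fst).add (hd.comp measurable_snd)).prodMk
      (hφ.measurable.comp measurable_snd)
  refine ⟨hm, Measure.AbsolutelyContinuous.mk fun B hB h0 => ?_⟩
  rw [Measure.map_apply hm hB]
  rw [Measure.volume_eq_prod, Measure.prod_apply_symm hB, lintegral_eq_zero_iff
    (measurable_measure_prodMk_right hB)] at h0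
  rw [Measure.volume_eq_prod, Measure.prod_apply_symm (hm hB), lintegral_eq_zero_iff
    (measurable_measure_prodMk_right (hm hB))]
  filter_upwards [hφ.ae h0] with ω hω
  exact (quasiMeasurePreserving_affine (hc0 ω) (d ω)).preimage_null hω

end Nonsingular

section LinearizedTower

open Classical in
theorem IsTower.exists_returnMap {Ω : Type*} [MeasurableSpace Ω] {S : Ω → Ω} {Δ : ℕ → Set Ω}
    (hT : IsTower S Δ) (hΔ : ∀ n, MeasurableSet (Δ n)) (hS : Measurable S) :
    ∃ F, Measurable F ∧ IsReturnMap S Δ F := by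
  have hF : IsReturnMap S Δ fun p => if h : ∃ k, S p ∈ Δ k then S^[Nat.find h + 1] p else p := by
    intro p k hk
    have h : ∃ k, S p ∈ Δ k := ⟨k, hk⟩
    simp only [dif_pos h, hT.eq_of_mem (Nat.find_spec h) hk]
  refine ⟨_, ?_, hF⟩
  refine measurable_of_forall_eqOn (ι := Option ℕ)
    (D := fun i => i.elim (S ⁻¹' ⋃ k, Δ k)ᶜ fun k => S ⁻¹' Δ k)
    (g := fun i => i.elim id fun k => S^[k + 1]) ?_ ?_ ?_ ?_
  · rintro (_ | k)
    exacts [(hS (MeasurableSet.iUnion hΔ)).compl, hS (hΔ k)]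
  · intro p
    by_cases hp : ∃ k, S p ∈ Δ k
    · exact ⟨some hp.choose, hp.choose_spec⟩
    · exact ⟨none, fun h => hp (mem_iUnion.1 h)⟩
  · rintro (_ | k)
    exacts [measurable_id, hS.iterate _]
  · rintro (_ | k) p hp
    · exact dif_neg fun h => hp (mem_iUnion.2 h)
    · exact hF p k hp

/-- The random piecewise affine maps interpolating the dynamics on the random preimages `X`. -/
structure IsLinearization (p₁ : ℝ) (X : ℕ → ℝ → ℝ) (Tt : ℝ → ℝ → ℝ) : Prop where
  right : ∀ ω : ℝ, ∀ x ∈ Ioc (1 / 2 : ℝ) 1, Tt ω x = 2 * x - 1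
  left : ∀ ω n, ∀ x ∈ Ioc (X (n + 2) ω) (X (n + 1) ω), Tt ω x =
    (X n (phiMap p₁ ω) - X (n + 1) (phiMap p₁ ω)) / (X (n + 1) ω - X (n + 2) ω) *
      (x - X (n + 2) ω) + X (n + 1) (phiMap p₁ ω)

/-- The skew product, made measurable by declaring the fibre maps to be the identity off
`(0,1]`. -/
def fillSkew (Tt : ℝ → ℝ → ℝ) (p₁ : ℝ) (p : ℝ × ℝ) : ℝ × ℝ :=
  if p.1 ∈ Ioc (0 : ℝ) 1 then skewOf Tt p₁ p else (p.1, phiMap p₁ p.2)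

/-- The levels of the tower over `Δ0`. -/
def towerLevel (X : ℕ → ℝ → ℝ) (n : ℕ) : Set (ℝ × ℝ) :=
  {p | p.2 ∈ Icc (0 : ℝ) 1 ∧ p.1 ∈ Ioc (X (n + 1) p.2) (X n p.2)}

variable {α β p₁ : ℝ} {X : ℕ → ℝ → ℝ} {Tt : ℝ → ℝ → ℝ}

theorem IsLinearization.fillSkew_right (h : IsLinearization p₁ X Tt) {x ω : ℝ}
    (hx : x ∈ Ioc (1 / 2 : ℝ) 1) : fillSkew Tt p₁ (x, ω) = (2 * x - 1, phiMap p₁ ω) := by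
  have hx' : (x, ω).1 ∈ Ioc (0 : ℝ) 1 := ⟨by linarith [hx.1], hx.2⟩
  rw [fillSkew, if_pos hx', skewOf, h.right ω x hx]

theorem phiMap_mem_Icc (h0 : 0 < p₁) (h1 : p₁ < 1) {ω : ℝ} (hω : ω ∈ Icc (0 : ℝ) 1) :
    phiMap p₁ ω ∈ Icc (0 : ℝ) 1 := by
  unfold phiMap
  split_ifs with h
  · exact ⟨div_nonneg hω.1 h0.le, (div_le_one h0).2 h.le⟩
  · have : 0 < 1 - p₁ := by linarith
    exact ⟨div_nonneg (by linarith) this.le, (div_le_one this).2 (by linarith [hω.2])⟩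

namespace IsRandomPreimages

theorem towerLevel_zero (h : IsRandomPreimages α β p₁ X) : towerLevel X 0 = Δ0 := by
  ext p
  simp only [towerLevel, Δ0, zero_add, h.zero, h.one, mem_ofPred_eq, mem_prod]
  tauto

theorem measurableSet_strip (h : IsRandomPreimages α β p₁ X) (n : ℕ) :
    MeasurableSet {p : ℝ × ℝ | p.1 ∈ Ioc (X (n + 1) p.2) (X n p.2)} :=
  (measurableSet_lt ((h.measurable _).comp measurable_snd) measurable_fst).inter
    (measurableSet_le measurable_fst ((h.measurable _).comp measurable_snd))

theorem measurableSet_towerLevel (h : IsRandomPreimages α β p₁ X) (n : ℕ) :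
    MeasurableSet (towerLevel X n) :=
  (measurable_snd measurableSet_Icc).inter (h.measurableSet_strip n)

theorem iUnion_towerLevel (h : IsRandomPreimages α β p₁ X) :
    ⋃ n, towerLevel X n = Ioc (0 : ℝ) 1 ×ˢ Icc (0 : ℝ) 1 := by
  ext p
  rw [mem_prod, ← h.iUnion_Ioc p.2, mem_iUnion, mem_iUnion, and_comm, ← exists_and_left]
  rfl

theorem strip_subset (h : IsRandomPreimages α β p₁ X) (n : ℕ) (ω : ℝ) :
    Ioc (X (n + 1) ω) (X n ω) ⊆ Ioc 0 1 :=
  Ioc_subset_Ioc (h.X_pos _ ω).le (h.le_one n ω)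

theorem fillSkew_left (hX : IsRandomPreimages α β p₁ X) (h : IsLinearization p₁ X Tt) {n : ℕ}
    {x ω : ℝ} (hx : x ∈ Ioc (X (n + 2) ω) (X (n + 1) ω)) :
    fillSkew Tt p₁ (x, ω) = ((X n (phiMap p₁ ω) - X (n + 1) (phiMap p₁ ω)) /
      (X (n + 1) ω - X (n + 2) ω) * (x - X (n + 2) ω) + X (n + 1) (phiMap p₁ ω),
        phiMap p₁ ω) := by
  have hx' : (x, ω).1 ∈ Ioc (0 : ℝ) 1 := hX.strip_subset (n + 1) ω hx
  rw [fillSkew, if_pos hx', skewOf, h.left ω n x hx]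

theorem isTower (hX : IsRandomPreimages α β p₁ X) (h : IsLinearization p₁ X Tt) :
    IsTower (fillSkew Tt p₁) (towerLevel X) where
  eq_of_mem := by
    intro m n p hm hn
    by_contra hne
    exact Set.disjoint_left.1 (hX.pairwise_disjoint_Ioc p.2 hne) hm.2 hn.2
  mapsTo_succ := by
    rintro n ⟨x, ω⟩ ⟨hω, hx⟩
    simp only at hω hx
    rw [hX.fillSkew_left h hx]
    refine ⟨phiMap_mem_Icc hX.pos hX.lt_one hω, ?_⟩
    have h1 : 0 < X (n + 1) ω - X (n + 2) ω := sub_pos.2 (hX.succ_lt _ _)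
    have h2 : 0 < X n (phiMap p₁ ω) - X (n + 1) (phiMap p₁ ω) := sub_pos.2 (hX.succ_lt _ _)
    have h3 : 0 < x - X (n + 2) ω := sub_pos.2 hx.1
    have h4 : x - X (n + 2) ω ≤ X (n + 1) ω - X (n + 2) ω := by linarith [hx.2]
    simp only [mem_Ioc]
    refine ⟨by linarith [mul_pos (div_pos h2 h1) h3], ?_⟩
    have h5 := mul_le_mul_of_nonneg_left h4 (div_pos h2 h1).le
    rw [div_mul_cancel₀ _ h1.ne'] at h5
    linarith
  mapsTo_zero := by
    rw [hX.towerLevel_zero, hX.iUnion_towerLevel]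
    rintro ⟨x, ω⟩ ⟨hx, hω⟩
    rw [h.fillSkew_right hx]
    simp only at hx hω
    exact ⟨⟨by linarith [hx.1], by linarith [hx.2]⟩, phiMap_mem_Icc hX.pos hX.lt_one hω⟩

theorem quasiMeasurePreserving_fillSkew (hX : IsRandomPreimages α β p₁ X)
    (h : IsLinearization p₁ X Tt) :
    Measure.QuasiMeasurePreserving (fillSkew Tt p₁) volume volume := by
  have hφ := quasiMeasurePreserving_phiMap hX.pos hX.lt_one
  have hφm := measurable_phiMap p₁
  let r : ℕ → ℝ → ℝ := fun n ω => (X n (phiMap p₁ ω) - X (n + 1) (phiMap p₁ ω)) /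
      (X (n + 1) ω - X (n + 2) ω)
  have hr : ∀ n, Measurable (r n) := fun n =>
    (((hX.measurable n).comp hφm).sub ((hX.measurable _).comp hφm)).div
      ((hX.measurable _).sub (hX.measurable _))
  let c : Option ℕ → ℝ → ℝ := fun i ω => i.elim 1 fun n => Nat.casesOn n 2 fun n => r n ω
  let d : Option ℕ → ℝ → ℝ := fun i ω => i.elim 0 fun n => Nat.casesOn n (-1) fun n =>
    X (n + 1) (phiMap p₁ ω) - r n ω * X (n + 2) ω
  refine quasiMeasurePreserving_of_forall_eqOn (ι := Option ℕ)
    (D := fun i => i.elim {p | p.1 ∉ Ioc (0 : ℝ) 1}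
      fun n => {p | p.1 ∈ Ioc (X (n + 1) p.2) (X n p.2)})
    (g := fun i p => (c i p.2 * p.1 + d i p.2, phiMap p₁ p.2)) ?_ ?_ ?_ ?_
  · rintro (_ | n)
    exacts [(measurable_fst measurableSet_Ioc).compl, hX.measurableSet_strip n]
  · intro p
    by_cases hp : p.1 ∈ Ioc (0 : ℝ) 1
    · obtain ⟨n, hn⟩ := hX.exists_mem_Ioc hp p.2
      exact ⟨some n, hn⟩
    · exact ⟨none, hp⟩
  · rintro (_ | _ | n)
    · exact quasiMeasurePreserving_skew_affine measurable_const measurable_const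
        (fun _ => one_ne_zero) hφ
    · exact quasiMeasurePreserving_skew_affine measurable_const measurable_const
        (fun _ => two_ne_zero) hφ
    · refine quasiMeasurePreserving_skew_affine (hr n)
        (((hX.measurable _).comp hφm).sub ((hr n).mul (hX.measurable _))) (fun ω => ?_) hφ
      exact (div_pos (sub_pos.2 (hX.succ_lt _ _)) (sub_pos.2 (hX.succ_lt _ _))).ne'
  · rintro (_ | _ | n) ⟨x, ω⟩ hx
    · have hx' : x ∉ Ioc (0 : ℝ) 1 := hx
      simp [fillSkew, hx', c, d]
    · have hx' : x ∈ Ioc (X (0 + 1) ω) (X 0 ω) := hx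
      rw [zero_add, hX.zero, hX.one] at hx'
      rw [h.fillSkew_right hx']
      simp [c, d, sub_eq_add_neg]
    · have hx' : x ∈ Ioc (X (n + 2) ω) (X (n + 1) ω) := hx
      rw [hX.fillSkew_left h hx']
      simp only [c, d, Option.elim_some, Prod.mk.injEq, and_true, r]
      ring

end IsRandomPreimages

end LinearizedTower

section Branches

theorem setLIntegral_image_affine {c : ℝ} (hc : 0 < c) (d : ℝ) {s : Set ℝ} (hs : MeasurableSet s)
    (g : ℝ → ENNReal) :
    ∫⁻ x in (fun x => c * x + d) '' s, g x = ENNReal.ofReal c * ∫⁻ x in s, g (c * x + d) := by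
  rw [lintegral_image_eq_lintegral_abs_deriv_mul hs (f' := fun _ => c), abs_of_pos hc,
    lintegral_const_mul' _ _ ENNReal.ofReal_ne_top]
  · intro x _
    simpa using (((hasDerivAt_id x).const_mul c).add_const d).hasDerivWithinAt
  · intro x _ y _ hxy
    simpa [hc.ne'] using hxy

/-- Contraction rates of the inverse branches of the noise dynamics. -/
def noiseRate (p₁ : ℝ) (b : Bool) : ℝ := cond b p₁ (1 - p₁)

/-- The inverse branches of the noise dynamics. -/
def noiseBranch (p₁ : ℝ) (b : Bool) (ω : ℝ) : ℝ := noiseRate p₁ b * ω + cond b 0 p₁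

/-- Compositions of inverse branches of the noise dynamics along a word. -/
def wordBranch (p₁ : ℝ) : ∀ {n : ℕ}, (Fin n → Bool) → ℝ → ℝ
  | 0, _ => id
  | _ + 1, w => fun ω => noiseBranch p₁ (w 0) (wordBranch p₁ (Fin.tail w) ω)

/-- The length of the cylinder of the noise dynamics coded by a word. -/
def wordProb (p₁ : ℝ) : ∀ {n : ℕ}, (Fin n → Bool) → ENNReal
  | 0, _ => 1
  | _ + 1, w => ENNReal.ofReal (noiseRate p₁ (w 0)) * wordProb p₁ (Fin.tail w)

variable {α β p₁ : ℝ} {X : ℕ → ℝ → ℝ} {Tt : ℝ → ℝ → ℝ}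

theorem noiseRate_pos (h0 : 0 < p₁) (h1 : p₁ < 1) (b : Bool) : 0 < noiseRate p₁ b := by
  cases b
  · simpa [noiseRate] using h1
  · exact h0

theorem noiseRate_lt_one (h0 : 0 < p₁) (h1 : p₁ < 1) (b : Bool) : noiseRate p₁ b < 1 := by
  cases b
  · simpa [noiseRate] using h0
  · exact h1

theorem noiseBranch_lt_iff (h0 : 0 < p₁) (h1 : p₁ < 1) (b : Bool) {ω : ℝ}
    (hω : ω ∈ Ico (0 : ℝ) 1) : noiseBranch p₁ b ω < p₁ ↔ b = true := by
  obtain ⟨hω0, hω1⟩ := hω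
  cases b
  · have := mul_nonneg (sub_pos.2 h1).le hω0
    simp [noiseBranch, noiseRate, this]
  · have := mul_lt_mul_of_pos_left hω1 h0
    simpa [noiseBranch, noiseRate] using this

theorem noiseBranch_mem (h0 : 0 < p₁) (h1 : p₁ < 1) (b : Bool) {ω : ℝ}
    (hω : ω ∈ Ico (0 : ℝ) 1) : noiseBranch p₁ b ω ∈ Ico (0 : ℝ) 1 := by
  obtain ⟨hω0, hω1⟩ := hω
  cases b
  · have h2 := mul_nonneg (sub_pos.2 h1).le hω0
    have h3 := mul_lt_mul_of_pos_left hω1 (sub_pos.2 h1)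
    simp only [noiseBranch, noiseRate, cond_false, mem_Ico]
    constructor <;> linarith
  · have h2 := mul_nonneg h0.le hω0
    have h3 := mul_lt_mul_of_pos_left hω1 h0
    simp only [noiseBranch, noiseRate, cond_true, mem_Ico]
    constructor <;> linarith

theorem phiMap_noiseBranch (h0 : 0 < p₁) (h1 : p₁ < 1) (b : Bool) {ω : ℝ}
    (hω : ω ∈ Ico (0 : ℝ) 1) : phiMap p₁ (noiseBranch p₁ b ω) = ω := by
  have h := noiseBranch_lt_iff h0 h1 b hω
  have h2 : 1 - p₁ ≠ 0 := by linarith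
  cases b
  · rw [phiMap, if_neg (by simpa using h)]
    simp only [noiseBranch, noiseRate, cond_false]
    field_simp
    ring
  · rw [phiMap, if_pos (by simpa using h)]
    simp only [noiseBranch, noiseRate, cond_true]
    field_simp
    ring

theorem alphaOf_noiseBranch (h0 : 0 < p₁) (h1 : p₁ < 1) (b : Bool) {ω : ℝ}
    (hω : ω ∈ Ico (0 : ℝ) 1) : alphaOf α β p₁ (noiseBranch p₁ b ω) = cond b α β := by
  have h := noiseBranch_lt_iff h0 h1 b hω
  cases b
  · rw [alphaOf, if_neg (by simpa using h), cond_false]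
  · rw [alphaOf, if_pos (by simpa using h), cond_true]

theorem wordBranch_mem (h0 : 0 < p₁) (h1 : p₁ < 1) {n : ℕ} (w : Fin n → Bool) {ω : ℝ}
    (hω : ω ∈ Ico (0 : ℝ) 1) : wordBranch p₁ w ω ∈ Ico (0 : ℝ) 1 := by
  induction n with
  | zero => exact hω
  | succ n ih => exact noiseBranch_mem h0 h1 _ (ih _)

theorem measurable_noiseBranch (p₁ : ℝ) (b : Bool) : Measurable (noiseBranch p₁ b) :=
  (measurable_const_mul _).add_const _

theorem measurable_wordBranch (p₁ : ℝ) {n : ℕ} (w : Fin n → Bool) :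
    Measurable (wordBranch p₁ w) := by
  induction n with
  | zero => exact measurable_id
  | succ n ih => exact (measurable_noiseBranch p₁ _).comp (ih _)

theorem dist_noiseBranch (h0 : 0 < p₁) (h1 : p₁ < 1) (b : Bool) (x y : ℝ) :
    dist (noiseBranch p₁ b x) (noiseBranch p₁ b y) = noiseRate p₁ b * dist x y := by
  rw [noiseBranch, noiseBranch, dist_add_right, Real.dist_eq, Real.dist_eq, ← mul_sub, abs_mul,
    abs_of_pos (noiseRate_pos h0 h1 b)]

theorem dist_wordBranch_le (h0 : 0 < p₁) (h1 : p₁ < 1) {n : ℕ} (w : Fin n → Bool) (x y : ℝ) :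
    dist (wordBranch p₁ w x) (wordBranch p₁ w y) ≤ dist x y := by
  induction n with
  | zero => exact le_rfl
  | succ n ih =>
    refine (dist_noiseBranch h0 h1 _ _ _).trans_le ?_
    exact (mul_le_of_le_one_left dist_nonneg (noiseRate_lt_one h0 h1 _).le).trans (ih _)

theorem lintegral_noiseBranch (h0 : 0 < p₁) (h1 : p₁ < 1) (g : ℝ → ENNReal) :
    ∫⁻ ω in Ico (0 : ℝ) 1, g ω = ∑ b, ENNReal.ofReal (noiseRate p₁ b) *
      ∫⁻ ω in Ico (0 : ℝ) 1, g (noiseBranch p₁ b ω) := by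
  rw [← Ico_union_Ico_eq_Ico h0.le h1.le, lintegral_union measurableSet_Ico
    (Set.disjoint_left.2 fun x hx hx' => absurd hx.2 (not_lt.2 hx'.1)),
    Ico_union_Ico_eq_Ico h0.le h1.le, Fintype.sum_bool]
  have key : ∀ b, ENNReal.ofReal (noiseRate p₁ b) *
      ∫⁻ ω in Ico (0 : ℝ) 1, g (noiseBranch p₁ b ω) =
        ∫⁻ x in noiseBranch p₁ b '' Ico 0 1, g x := fun b =>
    (setLIntegral_image_affine (noiseRate_pos h0 h1 b) _ measurableSet_Ico g).symm
  rw [key, key]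
  have himg : ∀ b, noiseBranch p₁ b '' Ico 0 1 = Ico (cond b 0 p₁) (cond b p₁ 1) := by
    intro b
    refine (image_affine_Ico (noiseRate_pos h0 h1 b) _ _ _).trans ?_
    cases b <;> simp [noiseRate]
  rw [himg, himg]
  rfl

theorem lintegral_wordBranch (h0 : 0 < p₁) (h1 : p₁ < 1) (n : ℕ) (g : ℝ → ENNReal) :
    ∫⁻ ω in Ico (0 : ℝ) 1, g ω = ∑ w : Fin n → Bool, wordProb p₁ w *
      ∫⁻ ω in Ico (0 : ℝ) 1, g (wordBranch p₁ w ω) := by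
  induction n generalizing g with
  | zero => simp [wordProb, wordBranch]
  | succ n ih =>
    rw [lintegral_noiseBranch h0 h1, ← (Fin.consEquiv fun _ => Bool).sum_comp,
      Fintype.sum_prod_type]
    refine Finset.sum_congr rfl fun b _ => ?_
    rw [ih, Finset.mul_sum]
    refine Finset.sum_congr rfl fun w _ => ?_
    simp [wordProb, wordBranch, Fin.consEquiv, mul_assoc]

namespace IsRandomPreimages

theorem X_wordBranch (h : IsRandomPreimages α β p₁ X) {n : ℕ} (w : Fin n → Bool) {m : ℕ}
    (hm : m ≤ n + 1) {ω : ℝ} (hω : ω ∈ Ico (0 : ℝ) 1) :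
    X m (wordBranch p₁ w ω) = X m (wordBranch p₁ w 0) := by
  have h00 : (0 : ℝ) ∈ Ico (0 : ℝ) 1 := ⟨le_rfl, one_pos⟩
  induction n generalizing m with
  | zero =>
    interval_cases m
    · rw [h.zero, h.zero]
    · rw [h.one, h.one]
  | succ n ih =>
    rcases m with _ | _ | m
    · rw [h.zero, h.zero]
    · rw [zero_add, h.one, h.one]
    · have hw := wordBranch_mem h.pos h.lt_one (Fin.tail w) hω
      have hw0 := wordBranch_mem h.pos h.lt_one (Fin.tail w) h00
      refine (h.lsv_strictMonoOn (wordBranch p₁ w ω)).injOn (h.succ_mem_Icc _ _)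
        (h.succ_mem_Icc _ _) ?_
      have hα : alphaOf α β p₁ (wordBranch p₁ w ω) = alphaOf α β p₁ (wordBranch p₁ w 0) := by
        rw [wordBranch, alphaOf_noiseBranch h.pos h.lt_one _ hw,
          alphaOf_noiseBranch h.pos h.lt_one _ hw0]
      rw [h.map, hα, h.map, wordBranch, phiMap_noiseBranch h.pos h.lt_one _ hw,
        phiMap_noiseBranch h.pos h.lt_one _ hw0]
      exact ih _ (by omega)

theorem iterate_fillSkew (hX : IsRandomPreimages α β p₁ X) (h : IsLinearization p₁ X Tt) {n : ℕ}
    (w : Fin n → Bool) {t : ℝ} (ht : t ∈ Ioc (0 : ℝ) 1) {ω : ℝ} (hω : ω ∈ Ico (0 : ℝ) 1) :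
    (fillSkew Tt p₁)^[n] (X (n + 1) (wordBranch p₁ w ω) +
      t * (X n (wordBranch p₁ w ω) - X (n + 1) (wordBranch p₁ w ω)), wordBranch p₁ w ω) =
        ((1 + t) / 2, ω) := by
  induction n with
  | zero =>
    simp only [zero_add, hX.zero, hX.one, Function.iterate_zero, id, wordBranch, Prod.mk.injEq,
      and_true]
    ring
  | succ n ih =>
    have hw := wordBranch_mem hX.pos hX.lt_one (Fin.tail w) hω
    have hφ : phiMap p₁ (wordBranch p₁ w ω) = wordBranch p₁ (Fin.tail w) ω :=
      phiMap_noiseBranch hX.pos hX.lt_one _ hw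
    have hpos : 0 < X (n + 1) (wordBranch p₁ w ω) - X (n + 2) (wordBranch p₁ w ω) :=
      sub_pos.2 (hX.succ_lt _ _)
    have h1 := mul_pos ht.1 hpos
    have h2 := mul_le_of_le_one_left hpos.le ht.2
    rw [Function.iterate_succ_apply, hX.fillSkew_left h (n := n), hφ, ← ih (Fin.tail w)]
    · congr 2
      field_simp
      ring
    · constructor <;> linarith

theorem sub_succ_pos (h : IsRandomPreimages α β p₁ X) (n : ℕ) (ω : ℝ) : 0 < X n ω - X (n + 1) ω :=
  _root_.sub_pos.2 (h.succ_lt n ω)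

theorem sub_succ_le_half (h : IsRandomPreimages α β p₁ X) (n : ℕ) (ω : ℝ) :
    X n ω - X (n + 1) ω ≤ 1 / 2 := by
  rcases n with _ | n
  · rw [zero_add, h.zero, h.one]; norm_num
  · linarith [(h.succ_mem n ω).2, h.X_pos (n + 2) ω]

end IsRandomPreimages

/-- Codes of the inverse branches of the first return map to `Δ0`. -/
abbrev BranchCode : Type := Bool × Σ n : ℕ, (Fin n → Bool)

/-- The length of the level above the noise cylinder given by a code. -/
def branchLength (X : ℕ → ℝ → ℝ) (p₁ : ℝ) (i : BranchCode) : ℝ :=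
  X i.2.1 (wordBranch p₁ i.2.2 0) - X (i.2.1 + 1) (wordBranch p₁ i.2.2 0)

/-- The inverse branches of the first return map to `Δ0`. -/
def returnBranch (X : ℕ → ℝ → ℝ) (p₁ : ℝ) (i : BranchCode) (p : ℝ × ℝ) : ℝ × ℝ :=
  (branchLength X p₁ i * p.1 +
      (1 + X (i.2.1 + 1) (wordBranch p₁ i.2.2 0) - branchLength X p₁ i) / 2,
    noiseBranch p₁ i.1 (wordBranch p₁ i.2.2 p.2))

theorem measurable_returnBranch (X : ℕ → ℝ → ℝ) (p₁ : ℝ) (i : BranchCode) :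
    Measurable (returnBranch X p₁ i) :=
  ((measurable_fst.const_mul _).add_const _).prodMk
    (((measurable_noiseBranch p₁ _).comp (measurable_wordBranch p₁ _)).comp measurable_snd)

/-- The relative measures of the images of the inverse branches of the first return map. -/
def branchProb (X : ℕ → ℝ → ℝ) (p₁ : ℝ) (i : BranchCode) : ENNReal :=
  ENNReal.ofReal (noiseRate p₁ i.1) * (wordProb p₁ i.2.2 * ENNReal.ofReal (branchLength X p₁ i))

/-- Normalized Lebesgue measure on the base `Δ0`. -/
def baseMeasure : Measure (ℝ × ℝ) :=
  (2 : ENNReal) • (volume.restrict (Ioc (1 / 2 : ℝ) 1)).prod (volume.restrict (Ico (0 : ℝ) 1))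

theorem lintegral_baseMeasure {g : ℝ × ℝ → ENNReal} (hg : Measurable g) :
    ∫⁻ p, g p ∂baseMeasure = 2 * ∫⁻ ω in Ico (0 : ℝ) 1, ∫⁻ x in Ioc (1 / 2 : ℝ) 1, g (x, ω) := by
  rw [baseMeasure, lintegral_smul_measure, lintegral_prod_symm _ hg.aemeasurable, smul_eq_mul]

namespace IsRandomPreimages

theorem iUnion_preimage_Ioc (hX : IsRandomPreimages α β p₁ X) (ω : ℝ) :
    ⋃ n, (fun x : ℝ => 2 * x - 1) ⁻¹' Ioc (X (n + 1) ω) (X n ω) = Ioc (1 / 2) 1 := by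
  rw [← preimage_iUnion, hX.iUnion_Ioc]
  ext x
  simp only [mem_preimage, mem_Ioc]
  constructor <;> rintro ⟨h1, h2⟩ <;> constructor <;> linarith

theorem image_affine_base (hX : IsRandomPreimages α β p₁ X) {n : ℕ} (ω : ℝ) :
    (fun x => (X n ω - X (n + 1) ω) * x + (1 + X (n + 1) ω - (X n ω - X (n + 1) ω)) / 2) ''
      Ioc (1 / 2) 1 = (fun x : ℝ => 2 * x - 1) ⁻¹' Ioc (X (n + 1) ω) (X n ω) := by
  rw [image_affine_Ioc (hX.sub_succ_pos n ω)]
  ext x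
  simp only [mem_preimage, mem_Ioc]
  constructor <;> rintro ⟨h1, h2⟩ <;> constructor <;> linarith

theorem lintegral_returnBranch (hX : IsRandomPreimages α β p₁ X) {g : ℝ × ℝ → ENNReal}
    (hg : Measurable g) :
    ∫⁻ p, g p ∂baseMeasure = ∑' i, branchProb X p₁ i *
      ∫⁻ p, g (returnBranch X p₁ i p) ∂baseMeasure := by
  let G : ℕ → ℝ → ENNReal := fun n ω => ∫⁻ x in (fun x : ℝ => 2 * x - 1) ⁻¹'
    Ioc (X (n + 1) (phiMap p₁ ω)) (X n (phiMap p₁ ω)), g (x, ω)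
  have hpm : ∀ n ω, MeasurableSet ((fun x : ℝ => 2 * x - 1) ⁻¹' Ioc (X (n + 1) ω) (X n ω)) :=
    fun n ω => ((measurable_const_mul 2).sub_const 1) measurableSet_Ioc
  have hsplit : ∀ ω, ∫⁻ x in Ioc (1 / 2 : ℝ) 1, g (x, ω) = ∑' n, G n ω := by
    intro ω
    rw [← hX.iUnion_preimage_Ioc (phiMap p₁ ω), lintegral_iUnion (fun n => hpm n _)]
    exact fun m n hmn => (hX.pairwise_disjoint_Ioc (phiMap p₁ ω) hmn).preimage _
  have hGm : ∀ n, Measurable (G n) := by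
    intro n
    have hset : MeasurableSet {p : ℝ × ℝ | 2 * p.1 - 1 ∈
        Ioc (X (n + 1) (phiMap p₁ p.2)) (X n (phiMap p₁ p.2))} :=
      (((measurable_fst.const_mul 2).sub_const 1).prodMk
        ((measurable_phiMap p₁).comp measurable_snd)) (hX.measurableSet_strip n)
    have := Measurable.lintegral_prod_left (μ := (volume : Measure ℝ))
      (f := fun x ω => indicator {p : ℝ × ℝ | 2 * p.1 - 1 ∈
        Ioc (X (n + 1) (phiMap p₁ p.2)) (X n (phiMap p₁ p.2))} g (x, ω)) (hg.indicator hset)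
    convert this using 1
    funext ω
    simp only [G]
    rw [← lintegral_indicator (hpm n _)]
    rfl
  have hG : ∀ n b (w : Fin n → Bool), ∀ ω ∈ Ico (0 : ℝ) 1,
      G n (noiseBranch p₁ b (wordBranch p₁ w ω)) =
        ENNReal.ofReal (branchLength X p₁ (b, ⟨n, w⟩)) *
          ∫⁻ x in Ioc (1 / 2 : ℝ) 1, g (returnBranch X p₁ (b, ⟨n, w⟩) (x, ω)) := by
    intro n b w ω hω
    simp only [G]
    rw [phiMap_noiseBranch hX.pos hX.lt_one _ (wordBranch_mem hX.pos hX.lt_one w hω),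
      hX.X_wordBranch w le_rfl hω, hX.X_wordBranch w n.le_succ hω, ← hX.image_affine_base,
      setLIntegral_image_affine (hX.sub_succ_pos n _) _ measurableSet_Ioc]
    rfl
  have hGint : ∀ n, ∫⁻ ω in Ico (0 : ℝ) 1, G n ω = ∑ b, ∑ w : Fin n → Bool,
      branchProb X p₁ (b, ⟨n, w⟩) * ∫⁻ ω in Ico (0 : ℝ) 1,
        ∫⁻ x in Ioc (1 / 2 : ℝ) 1, g (returnBranch X p₁ (b, ⟨n, w⟩) (x, ω)) := by
    intro n
    rw [lintegral_noiseBranch hX.pos hX.lt_one]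
    refine Finset.sum_congr rfl fun b _ => ?_
    rw [lintegral_wordBranch hX.pos hX.lt_one n, Finset.mul_sum]
    refine Finset.sum_congr rfl fun w _ => ?_
    rw [setLIntegral_congr_fun measurableSet_Ico (hG n b w),
      lintegral_const_mul' _ _ ENNReal.ofReal_ne_top, branchProb]
    simp only [mul_assoc]
  have hbase : ∀ i, ∫⁻ p, g (returnBranch X p₁ i p) ∂baseMeasure =
      2 * ∫⁻ ω in Ico (0 : ℝ) 1, ∫⁻ x in Ioc (1 / 2 : ℝ) 1, g (returnBranch X p₁ i (x, ω)) :=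
    fun i => lintegral_baseMeasure (hg.comp (measurable_returnBranch X p₁ i))
  simp_rw [lintegral_baseMeasure hg, hsplit, lintegral_tsum fun n => (hGm n).aemeasurable, hGint,
    hbase, mul_left_comm _ (2 : ENNReal), ENNReal.tsum_mul_left, ENNReal.tsum_prod',
    ENNReal.tsum_sigma', tsum_fintype]
  rw [← Summable.tsum_finsetSum fun _ _ => ENNReal.summable]

end IsRandomPreimages

end Branches

section ReturnMap

variable {α β p₁ : ℝ} {X : ℕ → ℝ → ℝ} {Tt : ℝ → ℝ → ℝ} {F : ℝ × ℝ → ℝ × ℝ}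

instance : IsProbabilityMeasure baseMeasure := by
  constructor
  have h : (2 : ENNReal) * ENNReal.ofReal (1 - 1 / 2) = 1 := by
    rw [← ENNReal.ofReal_ofNat, ← ENNReal.ofReal_mul (by norm_num)]
    norm_num
  rw [baseMeasure, Measure.smul_apply, ← univ_prod_univ, Measure.prod_prod]
  simpa using h

theorem baseMeasure_eq_restrict : baseMeasure =
    (2 : ENNReal) • volume.restrict (Ioc (1 / 2 : ℝ) 1 ×ˢ Ico (0 : ℝ) 1) := by
  rw [baseMeasure, Measure.prod_restrict, ← Measure.volume_eq_prod]

theorem baseMeasure_absolutelyContinuous : baseMeasure ≪ volume := by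
  rw [baseMeasure_eq_restrict]
  exact (Measure.smul_absolutelyContinuous).trans Measure.restrict_le_self.absolutelyContinuous

theorem baseMeasure_compl : baseMeasure (Ioc (1 / 2 : ℝ) 1 ×ˢ Ico (0 : ℝ) 1)ᶜ = 0 := by
  rw [baseMeasure_eq_restrict, Measure.smul_apply,
    Measure.restrict_apply (measurableSet_Ioc.prod measurableSet_Ico).compl]
  simp

theorem restrict_Δ0_absolutelyContinuous {ν : Measure (ℝ × ℝ)} (hν : ν ≪ volume) :
    ν.restrict Δ0 ≪ baseMeasure := by
  have h : (Δ0 : Set (ℝ × ℝ)) =ᵐ[volume] Ioc (1 / 2 : ℝ) 1 ×ˢ Ico (0 : ℝ) 1 :=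
    Measure.set_prod_ae_eq (ae_eq_refl _) Ico_ae_eq_Icc.symm
  refine (hν.restrict Δ0).trans ?_
  rw [Measure.restrict_congr_set h, baseMeasure_eq_restrict]
  exact Measure.absolutelyContinuous_smul two_ne_zero

theorem mapsTo_returnBranch (hX : IsRandomPreimages α β p₁ X) (i : BranchCode) :
    MapsTo (returnBranch X p₁ i) (Ioc (1 / 2 : ℝ) 1 ×ˢ Ico (0 : ℝ) 1)
      (Ioc (1 / 2 : ℝ) 1 ×ˢ Ico (0 : ℝ) 1) := by
  obtain ⟨b, n, w⟩ := i
  rintro ⟨x, ω⟩ ⟨hx, hω⟩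
  refine ⟨?_, noiseBranch_mem hX.pos hX.lt_one _ (wordBranch_mem hX.pos hX.lt_one _ hω)⟩
  have h1 : branchLength X p₁ (b, ⟨n, w⟩) =
    X n (wordBranch p₁ w 0) - X (n + 1) (wordBranch p₁ w 0) := rfl
  have h2 := hX.sub_succ_pos n (wordBranch p₁ w 0)
  have h3 := hX.X_pos (n + 1) (wordBranch p₁ w 0)
  have h4 := hX.le_one n (wordBranch p₁ w 0)
  rw [← h1] at h2
  have h5 := mul_lt_mul_of_pos_left hx.1 h2
  have h6 := mul_le_mul_of_nonneg_left hx.2 h2.le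
  simp only [returnBranch, mem_Ioc]
  constructor <;> linarith

theorem isContractingBranchSystem_returnBranch (hX : IsRandomPreimages α β p₁ X)
    (h : IsLinearization p₁ X Tt) (hF : IsReturnMap (fillSkew Tt p₁) (towerLevel X) F) :
    IsContractingBranchSystem F baseMeasure (Ioc (1 / 2 : ℝ) 1 ×ˢ Ico (0 : ℝ) 1)
      (branchProb X p₁) (returnBranch X p₁)
      (ENNReal.ofReal (max (1 / 2) (max p₁ (1 - p₁)))) where
  lt_one := by
    rw [ENNReal.ofReal_lt_one]
    refine max_lt (by norm_num) (max_lt hX.lt_one ?_)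
    linarith [hX.pos]
  conull := baseMeasure_compl
  measurable i := measurable_returnBranch X p₁ i
  mapsTo := mapsTo_returnBranch hX
  edist_le := by
    rintro ⟨b, n, w⟩ ⟨x, ω⟩ - ⟨x', ω'⟩ -
    rw [edist_dist, edist_dist, ← ENNReal.ofReal_mul (by positivity)]
    refine ENNReal.ofReal_le_ofReal (max_le ?_ ?_)
    · have h1 : 0 < branchLength X p₁ (b, ⟨n, w⟩) := hX.sub_succ_pos _ _
      have h2 : branchLength X p₁ (b, ⟨n, w⟩) ≤ 1 / 2 := hX.sub_succ_le_half _ _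
      simp only [returnBranch]
      rw [dist_add_right, Real.dist_eq, ← mul_sub, abs_mul, abs_of_pos h1, ← Real.dist_eq]
      exact mul_le_mul (h2.trans (le_max_left _ _)) (le_max_left _ _) dist_nonneg (by positivity)
    · have h1 : noiseRate p₁ b ≤ max p₁ (1 - p₁) := by
        cases b
        exacts [le_max_right _ _, le_max_left _ _]
      simp only [returnBranch]
      rw [dist_noiseBranch hX.pos hX.lt_one]
      exact mul_le_mul (h1.trans (le_max_right _ _))
        ((dist_wordBranch_le hX.pos hX.lt_one _ _ _).trans (le_max_right _ _)) dist_nonneg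
        (by positivity)
  rightInv := by
    rintro ⟨b, n, w⟩ ⟨x, ω⟩ ⟨hx, hω⟩
    have hw := wordBranch_mem hX.pos hX.lt_one w hω
    have h1 : fillSkew Tt p₁ (returnBranch X p₁ (b, ⟨n, w⟩) (x, ω)) =
        (X (n + 1) (wordBranch p₁ w ω) + (2 * x - 1) *
          (X n (wordBranch p₁ w ω) - X (n + 1) (wordBranch p₁ w ω)), wordBranch p₁ w ω) := by
      have h2 := mapsTo_returnBranch hX (b, ⟨n, w⟩) (mk_mem_prod hx hω)
      rw [hX.X_wordBranch w le_rfl hω, hX.X_wordBranch w n.le_succ hω]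
      simp only [returnBranch] at h2 ⊢
      rw [h.fillSkew_right h2.1, phiMap_noiseBranch hX.pos hX.lt_one _ hw, branchLength]
      congr 1
      ring
    have ht : 2 * x - 1 ∈ Ioc (0 : ℝ) 1 := ⟨by linarith [hx.1], by linarith [hx.2]⟩
    have h2 : fillSkew Tt p₁ (returnBranch X p₁ (b, ⟨n, w⟩) (x, ω)) ∈ towerLevel X n := by
      have h3 := hX.sub_succ_pos n (wordBranch p₁ w ω)
      have h4 := mul_pos ht.1 h3
      have h5 := mul_le_of_le_one_left h3.le ht.2
      rw [h1]
      refine ⟨⟨hw.1, hw.2.le⟩, ?_⟩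
      simp only [mem_Ioc]
      constructor <;> linarith
    rw [hF _ n h2, Function.iterate_succ_apply, h1, hX.iterate_fillSkew h w ht hω]
    congr 1
    ring
  lintegral_eq g hg := hX.lintegral_returnBranch hg

end ReturnMap

section Conclusion

variable {α β p₁ : ℝ} {X : ℕ → ℝ → ℝ} {Tt : ℝ → ℝ → ℝ} {F : ℝ × ℝ → ℝ × ℝ}

theorem ergodic_returnMap (hX : IsRandomPreimages α β p₁ X) (h : IsLinearization p₁ X Tt)
    (hFm : Measurable F) (hF : IsReturnMap (fillSkew Tt p₁) (towerLevel X) F) :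
    Ergodic F baseMeasure := by
  refine (isContractingBranchSystem_returnBranch hX h hF).ergodic hFm ENNReal.one_ne_top ?_
  rintro ⟨x, ω⟩ ⟨hx, hω⟩ ⟨x', ω'⟩ ⟨hx', hω'⟩
  rw [edist_dist, ENNReal.ofReal_le_one]
  refine max_le ?_ ?_
  · exact abs_sub_le_iff.2 ⟨by linarith [hx.2, hx'.1], by linarith [hx'.2, hx.1]⟩
  · exact abs_sub_le_iff.2 ⟨by linarith [hω.2, hω'.1], by linarith [hω'.2, hω.1]⟩

theorem measure_skewOf_preimage {ν : Measure (ℝ × ℝ)}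
    (hν : ν (Ioc (0 : ℝ) 1 ×ˢ Icc (0 : ℝ) 1)ᶜ = 0) (A : Set (ℝ × ℝ)) :
    ν (skewOf Tt p₁ ⁻¹' A) = ν (fillSkew Tt p₁ ⁻¹' A) := by
  rw [← measure_inter_conull hν, ← measure_inter_conull (s := fillSkew Tt p₁ ⁻¹' A) hν]
  congr 1
  ext p
  simp only [mem_inter_iff, mem_preimage, and_congr_left_iff]
  intro hp
  rw [fillSkew, if_pos hp.1]

theorem measure_compl_Ioc_prod_Icc {ν : Measure (ℝ × ℝ)} (hν : ν ≪ volume)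
    (hν' : ν (Icc (0 : ℝ) 1 ×ˢ Icc (0 : ℝ) 1)ᶜ = 0) :
    ν (Ioc (0 : ℝ) 1 ×ˢ Icc (0 : ℝ) 1)ᶜ = 0 := by
  have h : (Ioc (0 : ℝ) 1 ×ˢ Icc (0 : ℝ) 1 : Set (ℝ × ℝ)) =ᵐ[volume]
      Icc (0 : ℝ) 1 ×ˢ Icc (0 : ℝ) 1 :=
    Measure.set_prod_ae_eq Ioc_ae_eq_Icc (ae_eq_refl _)
  rwa [measure_congr (hν.ae_eq h).compl]

theorem restrict_Δ0_eq_baseMeasure (hX : IsRandomPreimages α β p₁ X) (h : IsLinearization p₁ X Tt)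
    {ν : Measure (ℝ × ℝ)} (hν : ν ≪ volume) (hνU : ν (⋃ n, towerLevel X n)ᶜ = 0)
    (hS : MeasurePreserving (fillSkew Tt p₁) ν ν) (hν1 : ν Δ0 = 1) :
    ν.restrict Δ0 = baseMeasure := by
  have hT := hX.isTower h
  obtain ⟨F, hFm, hF⟩ := hT.exists_returnMap hX.measurableSet_towerLevel hS.measurable
  have hpres := hT.measurePreserving_returnMap hX.measurableSet_towerLevel hFm hF hS hνU
  rw [hX.towerLevel_zero, hν1] at hpres
  have : IsFiniteMeasure (ν.restrict Δ0) := ⟨by simp [hν1]⟩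
  obtain ⟨c, hc⟩ := (ergodic_returnMap hX h hFm hF).eq_smul_of_absolutelyContinuous
    (hpres ENNReal.one_ne_top) (restrict_Δ0_absolutelyContinuous hν)
  have hc1 := congrArg (fun μ => μ univ) hc
  simp only [Measure.restrict_apply_univ, hν1, Measure.smul_apply, measure_univ, smul_eq_mul,
    mul_one] at hc1
  rw [hc, ← hc1, one_smul]

theorem towerMeasure_univ_eq_top (hX : IsRandomPreimages α β p₁ X) (h : IsLinearization p₁ X Tt) :
    towerMeasure (fillSkew Tt p₁) (towerLevel X) baseMeasure univ = ⊤ := by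
  rw [IsTower.towerMeasure_univ (hX.quasiMeasurePreserving_fillSkew h).measurable]
  have hsub : ∀ k : ℕ, Ioc (1 / 2 : ℝ) (1 / 2 + 1 / (4 * (k + 1))) ×ˢ Ico (0 : ℝ) 1 ⊆
      fillSkew Tt p₁ ⁻¹' ⋃ j, towerLevel X (j + (k + 1)) := by
    rintro k ⟨x, ω⟩ ⟨hx, hω⟩
    have hk : (1 : ℝ) / (4 * (k + 1)) = 1 / (2 * (k + 1)) / 2 := by field_simp; norm_num
    have h1 : (1 : ℝ) / (2 * (k + 1)) ≤ 1 := by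
      rw [div_le_one (by positivity)]
      linarith [k.cast_nonneg (α := ℝ)]
    have hx' : x ∈ Ioc (1 / 2 : ℝ) 1 := ⟨hx.1, by linarith [hx.2]⟩
    have ht : 2 * x - 1 ∈ Ioc (0 : ℝ) 1 := ⟨by linarith [hx.1], by linarith [hx'.2]⟩
    obtain ⟨n, hn⟩ := hX.exists_mem_Ioc ht (phiMap p₁ ω)
    have hle : k + 1 ≤ n := by
      by_contra! hlt
      have h2 := hX.antitone (phiMap p₁ ω) (Nat.succ_le_of_lt hlt)
      have h3 := hX.inv_le k (phiMap p₁ ω)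
      simp only [Nat.succ_eq_add_one] at h2
      linarith [hn.1, hx.2]
    rw [mem_preimage, h.fillSkew_right hx', mem_iUnion]
    refine ⟨n - (k + 1), ?_⟩
    rw [Nat.sub_add_cancel hle]
    exact ⟨phiMap_mem_Icc hX.pos hX.lt_one (Ico_subset_Icc_self hω), hn⟩
  have hle : ∀ k : ℕ, ENNReal.ofReal (1 / 2 * (1 / (k + 1))) ≤
      baseMeasure (fillSkew Tt p₁ ⁻¹' ⋃ j, towerLevel X (j + (k + 1))) := by
    intro k
    refine le_trans (le_of_eq ?_) (measure_mono (hsub k))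
    have hk : (1 : ℝ) / 2 + 1 / (4 * (k + 1)) ≤ 1 := by
      have : (1 : ℝ) / (4 * (k + 1)) ≤ 1 / 4 := by
        gcongr
        linarith [k.cast_nonneg (α := ℝ)]
      linarith
    rw [baseMeasure, Measure.smul_apply, Measure.prod_prod,
      Measure.restrict_eq_self _ (Ioc_subset_Ioc_right hk), Measure.restrict_eq_self _ subset_rfl,
      Real.volume_Ioc, Real.volume_Ico, sub_zero, ENNReal.ofReal_one, mul_one, smul_eq_mul,
      ← ENNReal.ofReal_ofNat, ← ENNReal.ofReal_mul (by norm_num)]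
    congr 1
    field_simp
    ring
  have hdiv : ∑' k : ℕ, ENNReal.ofReal (1 / 2 * (1 / (k + 1))) = ⊤ := by
    by_contra hne
    have hs := ENNReal.summable_toReal hne
    have h2 : ∀ k : ℕ, (ENNReal.ofReal (1 / 2 * (1 / ((k : ℝ) + 1)))).toReal =
        1 / 2 * (1 / ((k : ℝ) + 1)) := fun k => ENNReal.toReal_ofReal (by positivity)
    simp_rw [h2] at hs
    rw [summable_mul_left_iff (by norm_num)] at hs
    refine Real.not_summable_one_div_natCast ((summable_nat_add_iff 1).1 ?_)
    simpa using hs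
  refine top_le_iff.1 (hdiv.symm.le.trans ((ENNReal.tsum_le_tsum hle).trans ?_))
  exact ENNReal.tsum_comp_le_tsum_of_injective (add_left_injective 1)
    fun k => baseMeasure (fillSkew Tt p₁ ⁻¹' ⋃ j, towerLevel X (j + k))

end Conclusion

/-- Theorem 4.1 (1): the piecewise affine skew product with
`1 ≤ α < β < ∞` has a unique (normalized by `ν(Δ₀) = 1`) absolutely continuous invariant
σ-finite measure, and this measure is infinite. -/
theorem linearized_infinite_acim (α β p₁ : ℝ) (hα : 1 ≤ α) (hαβ : α < β)
    (hp₁ : 0 < p₁) (hp₁' : p₁ < 1)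
    (X : ℕ → ℝ → ℝ) (hX0 : ∀ ω, X 0 ω = 1) (hX1 : ∀ ω, X 1 ω = 1 / 2)
    (hX : ∀ n, 2 ≤ n → ∀ ω, X n ω ∈ Ioc (0 : ℝ) (1 / 2) ∧
      lsv (alphaOf α β p₁ ω) (X n ω) = X (n - 1) (phiMap p₁ ω))
    (Tt : ℝ → ℝ → ℝ)
    (hTt1 : ∀ ω : ℝ, ∀ x ∈ Ioc (1 / 2 : ℝ) 1, Tt ω x = 2 * x - 1)
    (hTt2 : ∀ ω : ℝ, ∀ n, 2 ≤ n → ∀ x ∈ Ioc (X n ω) (X (n - 1) ω),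
      Tt ω x =
        (X (n - 2) (phiMap p₁ ω) - X (n - 1) (phiMap p₁ ω)) / (X (n - 1) ω - X n ω) *
            (x - X n ω) + X (n - 1) (phiMap p₁ ω)) :
    ∃ ν : Measure (ℝ × ℝ),
      (SigmaFinite ν ∧ ν ≪ (volume : Measure (ℝ × ℝ)) ∧
        ν ((Icc (0 : ℝ) 1 ×ˢ Icc (0 : ℝ) 1)ᶜ) = 0 ∧
        (∀ A : Set (ℝ × ℝ), MeasurableSet A → ν (skewOf Tt p₁ ⁻¹' A) = ν A) ∧
        ν Δ0 = 1) ∧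
      (∀ ν' : Measure (ℝ × ℝ),
        (SigmaFinite ν' ∧ ν' ≪ (volume : Measure (ℝ × ℝ)) ∧
          ν' ((Icc (0 : ℝ) 1 ×ˢ Icc (0 : ℝ) 1)ᶜ) = 0 ∧
          (∀ A : Set (ℝ × ℝ), MeasurableSet A → ν' (skewOf Tt p₁ ⁻¹' A) = ν' A) ∧
          ν' Δ0 = 1) → ν' = ν) ∧
      ν (Icc (0 : ℝ) 1 ×ˢ Icc (0 : ℝ) 1) = ⊤ := by
  have hR : IsRandomPreimages α β p₁ X :=
    { one_le := hα
      lt := hαβ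
      pos := hp₁
      lt_one := hp₁'
      zero := hX0
      one := hX1
      mem := fun n ω => (hX (n + 2) (by omega) ω).1
      map := fun n ω => (hX (n + 2) (by omega) ω).2 }
  have hL : IsLinearization p₁ X Tt := ⟨hTt1, fun ω n => hTt2 ω (n + 2) (by omega)⟩
  have hT := hR.isTower hL
  have hΔ := hR.measurableSet_towerLevel
  have hQ := hR.quasiMeasurePreserving_fillSkew hL
  obtain ⟨F, hFm, hF⟩ := hT.exists_returnMap hΔ hQ.measurable
  have hbase : baseMeasure (towerLevel X 0)ᶜ = 0 := by
    rw [hR.towerLevel_zero]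
    exact measure_mono_null
      (compl_subset_compl.2 (prod_mono subset_rfl Ico_subset_Icc_self)) baseMeasure_compl
  have hFμ := (ergodic_returnMap hR hL hFm hF).toMeasurePreserving
  set ν := towerMeasure (fillSkew Tt p₁) (towerLevel X) baseMeasure with hν
  have hac : ν ≪ volume :=
    IsTower.towerMeasure_absolutelyContinuous hQ baseMeasure_absolutelyContinuous
  have hS : MeasurePreserving (fillSkew Tt p₁) ν ν :=
    hT.measurePreserving_towerMeasure hΔ hQ.measurable hF hbase hFμ
  have hcompl : ν (⋃ n, towerLevel X n)ᶜ = 0 := hT.towerMeasure_compl hΔ hQ.measurable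
  have hres : ν.restrict (towerLevel X 0) = baseMeasure :=
    hT.towerMeasure_restrict_base hΔ hQ.measurable hF hbase hFμ
  have hU := hR.iUnion_towerLevel
  have hcompl' := hcompl
  rw [hU] at hcompl'
  have hIcc : ν (Icc (0 : ℝ) 1 ×ˢ Icc (0 : ℝ) 1)ᶜ = 0 :=
    measure_mono_null (compl_subset_compl.2 (prod_mono Ioc_subset_Icc_self subset_rfl)) hcompl'
  have hone : ν Δ0 = 1 := by
    rw [← hR.towerLevel_zero, ← Measure.restrict_apply_univ, hres, measure_univ]
  refine ⟨ν, ⟨hT.sigmaFinite_towerMeasure hΔ hQ.measurable, hac, hIcc, fun A hA => ?_, hone⟩,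
    ?_, ?_⟩
  · rw [measure_skewOf_preimage hcompl', hS.measure_preimage hA.nullMeasurableSet]
  · rintro ν' ⟨-, hac', hIcc', hinv', hone'⟩
    have hnull := measure_compl_Ioc_prod_Icc hac' hIcc'
    have hS' : MeasurePreserving (fillSkew Tt p₁) ν' ν' := by
      refine ⟨hQ.measurable, Measure.ext fun A hA => ?_⟩
      rw [Measure.map_apply hQ.measurable hA, ← measure_skewOf_preimage hnull, hinv' A hA]
    rw [← hU] at hnull
    refine hT.measure_ext hΔ hS' hS hnull hcompl ?_ ?_
    · rw [hR.towerLevel_zero, hone']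
      exact ENNReal.one_ne_top
    · rw [hres, hR.towerLevel_zero, restrict_Δ0_eq_baseMeasure hR hL hac' hnull hS' hone']
  · rw [← towerMeasure_univ_eq_top hR hL, ← hν, ← measure_inter_conull (s := univ) hIcc, univ_inter]
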